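/- arXiv:2010.00483 — 2 statements merged into one kernel-verified Lean document; each statement's English description precedes it below -/
import Mathlib

section
/- Quenched CLT along up-right paths with weights uniform on the solid simplex Δ_{(MN,≤)}: Let M = ⌊ξN⌋ with ξ > 0 fixed, and let the weight vector w = (w_{i,j})_{(i,j)∈□_{N,M}} be uniformly distributed on Δ_{(MN,≤)} = {x ∈ ℝ₊^{MN} : x_1 + ⋯ + x_{MN} ≤ MN}. Let σ be chosen uniformly at random from all up-right paths from (1,1) to (N,M), independently of w. Then P_w-almost surely, the quenched law of (M+N−1)^{−1/2} Σ_{(i,j)∈σ} (w_{i,j} − E w_{i,j}) converges weakly to the standard Gaussian distribution N(0,1) as N → ∞. -/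
open MeasureTheory ProbabilityTheory Real Filter

/-- The grid `□_{N,M} = {(i,j) : 1 ≤ i ≤ N, 1 ≤ j ≤ M}`. -/
def box (N M : ℕ) : Finset (ℕ × ℕ) := Finset.Icc 1 N ×ˢ Finset.Icc 1 M

/-- `s` is the set of sites of an up-right path from `(1,1)` to `(N,M)`. -/
def IsUpRightPath (N M : ℕ) (s : Finset (ℕ × ℕ)) : Prop :=
  ∃ c : ℕ → ℕ × ℕ, c 0 = (1, 1) ∧ c (N + M - 2) = (N, M) ∧
    (∀ k, k < N + M - 2 →
      c (k + 1) = ((c k).1 + 1, (c k).2) ∨ c (k + 1) = ((c k).1, (c k).2 + 1)) ∧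
    s = (Finset.range (N + M - 1)).image c

open scoped Classical in
/-- All up-right paths from `(1,1)` to `(N,M)`, as sets of sites. -/
noncomputable def upRightPaths (N M : ℕ) : Finset (Finset (ℕ × ℕ)) :=
  (box N M).powerset.filter (fun s => IsUpRightPath N M s)

/-- The quenched average `E_σ f((M+N-1)^{-1/2} Σ_{(i,j)∈σ} (W_{i,j} - E W_{i,j}))` over a
uniformly random up-right path `σ`, with `Wbar` the array of means. -/
noncomputable def pathAvgCentered (N M : ℕ) (W Wbar : ↥(box N M) → ℝ) (f : ℝ → ℝ) : ℝ :=
  ((upRightPaths N M).card : ℝ)⁻¹ *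
    ∑ s ∈ upRightPaths N M,
      f ((Real.sqrt ((M + N - 1 : ℕ) : ℝ))⁻¹ *
        ∑ a : ↥(box N M), if (a : ℕ × ℕ) ∈ s then W a - Wbar a else 0)

/-- The solid simplex `Δ_{(n,≤)} = {x ∈ ℝ₊^ι : Σ x_i ≤ card ι}` in Euclidean space. -/
def simplexLe (ι : Type) [Fintype ι] : Set (EuclideanSpace ℝ ι) :=
  {x | (∀ i, 0 ≤ x i) ∧ ∑ i, x i ≤ (Fintype.card ι : ℝ)}

/-- The uniform (normalized Lebesgue) probability measure on `Δ_{(n,≤)}`. -/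
noncomputable def simplexLeUniform (ι : Type) [Fintype ι] : Measure (EuclideanSpace ℝ ι) :=
  (volume (simplexLe ι))⁻¹ • volume.restrict (simplexLe ι)

/-- The generating polynomial `∑ₐ (k choose a)² Xᵃ` of the squared binomial coefficients. -/
noncomputable def sqChoosePoly (k : ℕ) : Polynomial ℝ :=
  ∑ a ∈ Finset.range (k + 1), Polynomial.monomial a ((k.choose a : ℝ) ^ 2)

lemma coeff_sqChoosePoly (k a : ℕ) : (sqChoosePoly k).coeff a = (k.choose a : ℝ) ^ 2 := by
  rw [sqChoosePoly, Polynomial.finsetSum_coeff]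
  simp only [Polynomial.coeff_monomial, Finset.sum_ite_eq', Finset.mem_range]
  split_ifs with h
  · rfl
  · rw [Nat.choose_eq_zero_of_lt (by omega)]; simp

lemma choose_succ_mul_real (k a : ℕ) :
    ((a : ℝ) + 1) * (k.choose (a + 1) : ℝ) = ((k : ℝ) - a) * (k.choose a : ℝ) := by
  rcases le_or_gt a k with h | h
  · have := Nat.choose_succ_right_eq k a
    rw [← Nat.cast_sub h]
    exact_mod_cast (by linarith : (a + 1) * k.choose (a + 1) = (k - a) * k.choose a)
  · rw [Nat.choose_eq_zero_of_lt h, Nat.choose_eq_zero_of_lt (by omega)]; simp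

open Polynomial in
lemma sqChoosePoly_recurrence (k : ℕ) :
    ((k : ℝ[X]) + 2) * sqChoosePoly (k + 2) =
      (2 * (k : ℝ[X]) + 3) * (1 + X) * sqChoosePoly (k + 1)
        - ((k : ℝ[X]) + 1) * (1 - X) ^ 2 * sqChoosePoly k := by
  have h1 : ((k : ℝ[X]) + 2) = C ((k : ℝ) + 2) := by simp [C_ofNat]
  have h2 : (2 * (k : ℝ[X]) + 3) = C (2 * (k : ℝ) + 3) := by simp [C_ofNat]
  have h3 : ((k : ℝ[X]) + 1) = C ((k : ℝ) + 1) := by simp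
  rw [h1, h2, h3]
  ext a
  have e1 : C (2 * (k : ℝ) + 3) * (1 + X) * sqChoosePoly (k + 1) =
    C (2 * (k : ℝ) + 3) * (sqChoosePoly (k + 1) + X * sqChoosePoly (k + 1)) := by ring
  have e2 : C ((k : ℝ) + 1) * (1 - X) ^ 2 * sqChoosePoly k =
    C ((k : ℝ) + 1) * (sqChoosePoly k + X * (X * sqChoosePoly k - C 2 * sqChoosePoly k)) := by
    rw [C_ofNat]; ring
  rw [e1, e2]
  simp only [coeff_sub, coeff_C_mul, coeff_add]
  rcases a with _ | _ | a
  · simp [coeff_sqChoosePoly]; ring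
  · simp [coeff_sqChoosePoly, coeff_X_mul]; ring
  · simp only [coeff_X_mul, coeff_sqChoosePoly, coeff_sub, coeff_C_mul]
    have r1 := choose_succ_mul_real k a
    have r2 := choose_succ_mul_real k (a + 1)
    simp only [Nat.choose_succ_succ' (k + 1), Nat.choose_succ_succ' k]
    push_cast at r1 r2 ⊢
    generalize (k.choose (a + 1 + 1) : ℝ) = u at *
    generalize (k.choose (a + 1) : ℝ) = v at *
    generalize (k.choose a : ℝ) = w at *
    generalize (k : ℝ) = k at *
    generalize (a : ℝ) = a at *
    linear_combination 2 * (w * r2 - u * r1 + v * r2 - v * r1)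

open Polynomial in
lemma sqChoosePoly_zero : sqChoosePoly 0 = 1 := by simp [sqChoosePoly]

open Polynomial in
lemma sqChoosePoly_one : sqChoosePoly 1 = 1 + X := by
  simp [sqChoosePoly, Finset.sum_range_succ, monomial_one_one_eq_X]

/-- A sequence obeying the Legendre recurrence has as generating series the inverse square root of
`1 - 2 s t + dt²`. -/
lemma mk_sq_mul_of_legendre_recurrence {R : Type*} [CommRing R] [IsAddTorsionFree R] (p : ℕ → R)
    (s d : R) (h0 : p 0 = 1) (h1 : p 1 = s)
    (h : ∀ k : ℕ, ((k : R) + 2) * p (k + 2) =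
      (2 * (k : R) + 3) * s * p (k + 1) - ((k : R) + 1) * d * p k) :
    (PowerSeries.mk p) ^ 2 *
      (1 - PowerSeries.C (2 * s) * PowerSeries.X
        + PowerSeries.C d * (PowerSeries.X * PowerSeries.X)) = 1 := by
  set G : PowerSeries R := PowerSeries.mk p with hG
  set D : PowerSeries R := 1 - PowerSeries.C (2 * s) * PowerSeries.X
        + PowerSeries.C d * (PowerSeries.X * PowerSeries.X) with hD
  have ode : D * PowerSeries.derivative R G =
      (PowerSeries.C s - PowerSeries.C d * PowerSeries.X) * G := by
    ext1 n
    rw [hD]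
    simp only [add_mul, sub_mul, one_mul, mul_assoc, map_add, map_sub, PowerSeries.coeff_C_mul]
    rcases n with _ | _ | n
    · simp [hG, h0, h1, PowerSeries.coeff_zero_X_mul,
        PowerSeries.coeff_derivative]
    · have := h 0
      simp [hG, PowerSeries.coeff_succ_X_mul,
        PowerSeries.coeff_derivative, h0, h1] at this ⊢
      linear_combination this
    · have := h (n + 1)
      simp [hG, PowerSeries.coeff_succ_X_mul,
        PowerSeries.coeff_derivative] at this ⊢
      linear_combination this
  have dD : PowerSeries.derivative R D =
      -2 * (PowerSeries.C s - PowerSeries.C d * PowerSeries.X) := by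
    rw [hD, two_mul]
    simp only [map_add, map_sub, Derivation.leibniz, Derivation.map_one_eq_zero, smul_eq_mul,
      PowerSeries.derivative_X, PowerSeries.derivative_C]
    ring
  refine PowerSeries.derivative.ext ?_ ?_
  · rw [Derivation.leibniz, Derivation.leibniz_pow, dD, Derivation.map_one_eq_zero]
    simp only [smul_eq_mul, nsmul_eq_mul]
    push_cast
    linear_combination (2 * G) * ode
  · simp [hG, hD, h0]

open Polynomial in
lemma four_X_mul_expand_conv (n : ℕ) :
    4 * X * expand ℝ 2 (∑ p ∈ Finset.HasAntidiagonal.antidiagonal n, sqChoosePoly p.1 * sqChoosePoly p.2) =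
      (1 + X) ^ (2 * n + 2) - (1 - X) ^ (2 * n + 2) := by
  have key := mk_sq_mul_of_legendre_recurrence sqChoosePoly (1 + X) ((1 - X) ^ 2)
    sqChoosePoly_zero sqChoosePoly_one sqChoosePoly_recurrence
  set T : ℕ → ℝ[X] := fun n =>
    ∑ p ∈ Finset.HasAntidiagonal.antidiagonal n, sqChoosePoly p.1 * sqChoosePoly p.2 with hT
  have hTc : ∀ n, PowerSeries.coeff n ((PowerSeries.mk sqChoosePoly) ^ 2) = T n := fun n => by
    rw [pow_two, PowerSeries.coeff_mul]; simp [hT]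
  have hrec : ∀ n, T (n + 2) = 2 * (1 + X) * T (n + 1) - (1 - X) ^ 2 * T n := fun n => by
    have := congrArg (PowerSeries.coeff (n + 2)) key
    rw [mul_comm] at this
    simp only [add_mul, sub_mul, one_mul, mul_assoc, map_add, map_sub, PowerSeries.coeff_C_mul,
      PowerSeries.coeff_succ_X_mul, hTc, PowerSeries.coeff_one] at this
    simp at this
    linear_combination this
  have h0 : T 0 = 1 := by simp [hT, sqChoosePoly_zero]
  have h1 : T 1 = (1 + X) + (1 + X) := by
    simp [hT, sqChoosePoly_zero, sqChoosePoly_one, Finset.Nat.antidiagonal_succ]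
  change 4 * X * expand ℝ 2 (T n) = _
  clear_value T
  induction n using Nat.twoStepInduction with
  | zero => rw [h0]; simp; ring
  | one => rw [h1]; simp; ring
  | more n ih1 ih2 =>
    rw [hrec, two_mul]
    simp only [map_sub, map_mul, map_add, map_pow, map_one, expand_X]
    linear_combination 2 * (1 + X ^ 2) * ih2 - (1 - X ^ 2) ^ 2 * ih1

open Polynomial in
/-- The number of pairs of monotone paths from `(0,0)` to `(n-m,m)`, counted with the number of
their common sites. -/
lemma sum_sq_choose_mul_choose (n m : ℕ) :
    ∑ p ∈ Finset.HasAntidiagonal.antidiagonal n, ∑ q ∈ Finset.HasAntidiagonal.antidiagonal m,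
      ((p.1.choose q.1 : ℝ) * (p.2.choose q.2 : ℝ)) ^ 2 =
      ((2 * n + 2).choose (2 * m + 1) : ℝ) / 2 := by
  have := congrArg (fun P : ℝ[X] => P.coeff (2 * m + 1)) (four_X_mul_expand_conv n)
  have e : (1 - X : ℝ[X]) ^ (2 * n + 2) = ((1 + X) ^ (2 * n + 2)).comp (C (-1) * X) := by
    simp [sub_eq_add_neg]
  simp only [coeff_sub, e, comp_C_mul_X_coeff, coeff_one_add_X_pow] at this
  rw [show (4 : ℝ[X]) = C 4 by simp [C_ofNat], mul_assoc, coeff_C_mul, coeff_X_mul, mul_comm 2 m,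
    coeff_expand_mul (by norm_num), finsetSum_coeff] at this
  simp only [coeff_mul, coeff_sqChoosePoly] at this
  simp only [mul_pow]
  rw [mul_comm 2 m]
  have e2 : (-1 : ℝ) ^ (m * 2 + 1) = -1 := by
    rw [pow_succ, mul_comm, pow_mul']; simp
  rw [e2] at this
  linarith

lemma sq_centralBinom_mul_le (j : ℕ) : (j.centralBinom : ℝ) ^ 2 * (2 * j + 1) ≤ 16 ^ j := by
  induction j with
  | zero => simp
  | succ j ih =>
    have h := Nat.succ_mul_centralBinom_succ j
    have h' : ((j : ℝ) + 1) * ((j + 1).centralBinom : ℝ) = 2 * (2 * j + 1) * (j.centralBinom : ℝ) := by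
      exact_mod_cast h
    have hj : (0 : ℝ) < (j : ℝ) + 1 := by positivity
    have e : ((j + 1).centralBinom : ℝ) = 2 * (2 * j + 1) * (j.centralBinom : ℝ) / (j + 1) := by
      rw [eq_div_iff hj.ne']; linarith
    rw [e, pow_succ (16 : ℝ) j, div_pow, div_mul_eq_mul_div, div_le_iff₀ (by positivity)]
    push_cast
    calc (2 * (2 * (j : ℝ) + 1) * (j.centralBinom : ℝ)) ^ 2 * (2 * ((j : ℝ) + 1) + 1)
        = (j.centralBinom : ℝ) ^ 2 * (2 * j + 1) * (4 * ((2 * (j : ℝ) + 1) * (2 * j + 3))) := by ring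
      _ ≤ 16 ^ j * (4 * ((2 * (j : ℝ) + 1) * (2 * j + 3))) := by gcongr
      _ ≤ 16 ^ j * (16 * ((j : ℝ) + 1) ^ 2) := by gcongr 16 ^ j * ?_; nlinarith
      _ = _ := by ring

lemma le_sq_centralBinom_mul (j : ℕ) : 16 ^ j ≤ (j.centralBinom : ℝ) ^ 2 * (4 * j + 1) := by
  induction j with
  | zero => simp
  | succ j ih =>
    have h := Nat.succ_mul_centralBinom_succ j
    have h' : ((j : ℝ) + 1) * ((j + 1).centralBinom : ℝ) = 2 * (2 * j + 1) * (j.centralBinom : ℝ) := by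
      exact_mod_cast h
    have hj : (0 : ℝ) < (j : ℝ) + 1 := by positivity
    have e : ((j + 1).centralBinom : ℝ) = 2 * (2 * j + 1) * (j.centralBinom : ℝ) / (j + 1) := by
      rw [eq_div_iff hj.ne']; linarith
    rw [e, pow_succ (16 : ℝ) j, div_pow, div_mul_eq_mul_div, le_div_iff₀ (by positivity)]
    push_cast
    calc (16 : ℝ) ^ j * 16 * (j + 1) ^ 2 ≤
        ((j.centralBinom : ℝ) ^ 2 * (4 * j + 1)) * 16 * (j + 1) ^ 2 := by gcongr
      _ = (j.centralBinom : ℝ) ^ 2 * (4 * (4 * (4 * j + 1) * (j + 1) ^ 2)) := by ring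
      _ ≤ (j.centralBinom : ℝ) ^ 2 * (4 * ((2 * j + 1) ^ 2 * (4 * j + 5))) := by
        gcongr (j.centralBinom : ℝ) ^ 2 * (4 * ?_); nlinarith
      _ = _ := by ring

lemma sq_choose_two_mul_add_two_le (m k : ℕ) :
    (((2 * (m + k) + 2).choose (2 * m + 1) : ℝ) / 2) ^ 2 * ((m + 1) * (k + 1)) ≤
      8 * ((m : ℝ) + k + 1) ^ 3 * ((m + k).choose m : ℝ) ^ 4 := by
  have cb : ∀ j : ℕ, (j.centralBinom : ℝ) = (2 * j).factorial / ((j.factorial : ℝ) ^ 2) := by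
    intro j
    rw [Nat.centralBinom_eq_two_mul_choose, Nat.cast_choose ℝ (by omega)]
    congr 1
    rw [show 2 * j - j = j by omega, sq]
  have hm := le_sq_centralBinom_mul m
  have hk := le_sq_centralBinom_mul k
  have hn := sq_centralBinom_mul_le (m + k)
  have hcm : (0 : ℝ) < m.centralBinom := by exact_mod_cast m.centralBinom_pos
  have hck : (0 : ℝ) < k.centralBinom := by exact_mod_cast k.centralBinom_pos
  have key : ((2 * (m + k) + 2).choose (2 * m + 1) : ℝ) / 2 =
      ((m + k).choose m : ℝ) ^ 2 * (((m : ℝ) + k + 1) * (2 * (m + k) + 1)) *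
        ((m + k).centralBinom : ℝ) /
        ((2 * m + 1) * (2 * k + 1) * ((m.centralBinom : ℝ) * k.centralBinom)) := by
    rw [cb, cb, cb, Nat.cast_choose ℝ (by omega), Nat.cast_choose ℝ (by omega),
      show 2 * (m + k) + 2 - (2 * m + 1) = 2 * k + 1 by omega, show m + k - m = k by omega,
      Nat.factorial_succ (2 * m), Nat.factorial_succ (2 * k), Nat.factorial_succ (2 * (m + k) + 1),
      Nat.factorial_succ (2 * (m + k))]
    have f : ∀ j : ℕ, (j.factorial : ℝ) ≠ 0 := fun j => by exact_mod_cast j.factorial_ne_zero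
    have := f m; have := f k; have := f (2 * m); have := f (2 * k); have := f (m + k)
    push_cast
    field_simp
    ring
  have ratio : ((m + k).centralBinom : ℝ) ^ 2 * (2 * (m + k) + 1) ≤
      ((m.centralBinom : ℝ) * k.centralBinom) ^ 2 * ((4 * m + 1) * (4 * k + 1)) := by
    calc ((m + k).centralBinom : ℝ) ^ 2 * (2 * (m + k) + 1) ≤ 16 ^ m * 16 ^ k := by
          rw [← pow_add]; exact_mod_cast hn
      _ ≤ ((m.centralBinom : ℝ) ^ 2 * (4 * m + 1)) * ((k.centralBinom : ℝ) ^ 2 * (4 * k + 1)) := by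
          gcongr
      _ = _ := by ring
  rw [key, div_pow, div_mul_eq_mul_div, div_le_iff₀ (by positivity)]
  set B := ((m + k).choose m : ℝ)
  set c := (m.centralBinom : ℝ) * k.centralBinom
  set n := (m : ℝ) + k with hnn
  have hm0 : (0 : ℝ) ≤ m := by positivity
  have hk0 : (0 : ℝ) ≤ k := by positivity
  calc (B ^ 2 * ((n + 1) * (2 * n + 1)) * ((m + k).centralBinom : ℝ)) ^ 2 * ((m + 1) * (k + 1))
      = B ^ 4 * (n + 1) ^ 2 * (2 * n + 1) * (((m + k).centralBinom : ℝ) ^ 2 * (2 * n + 1)) *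
        ((m + 1) * (k + 1)) := by ring
    _ ≤ B ^ 4 * (n + 1) ^ 2 * (2 * (n + 1)) * (c ^ 2 * ((4 * m + 1) * (4 * k + 1))) *
        ((2 * m + 1) * (2 * k + 1)) := by
        gcongr <;> linarith
    _ ≤ B ^ 4 * (n + 1) ^ 2 * (2 * (n + 1)) * (c ^ 2 * ((2 * (2 * m + 1)) * (2 * (2 * k + 1)))) *
        ((2 * m + 1) * (2 * k + 1)) := by
        gcongr <;> linarith
    _ = _ := by ring

/-- The site reached after `k` steps when the steps to the right are those in `A`. -/
def stepSite (A : Finset ℕ) (k : ℕ) : ℕ × ℕ :=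
  (1 + (A.filter (· < k)).card, 1 + (k - (A.filter (· < k)).card))

/-- The sites of the `n`-step path whose steps to the right are those in `A`. -/
def stepPath (n : ℕ) (A : Finset ℕ) : Finset (ℕ × ℕ) :=
  (Finset.range (n + 1)).image (stepSite A)

lemma card_filter_lt_le (A : Finset ℕ) (k : ℕ) : (A.filter (· < k)).card ≤ k := by
  calc _ ≤ (Finset.range k).card := Finset.card_le_card fun x hx => by simp at hx ⊢; exact hx.2
    _ = k := by simp

lemma card_filter_lt_succ (A : Finset ℕ) (k : ℕ) :
    (A.filter (· < k + 1)).card = (A.filter (· < k)).card + if k ∈ A then 1 else 0 := by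
  have : A.filter (· < k + 1) = A.filter (· < k) ∪ (if k ∈ A then {k} else ∅) := by
    ext x
    by_cases h : k ∈ A
    · simp only [h, if_true, Finset.mem_filter, Finset.mem_union, Finset.mem_singleton]
      constructor
      · rintro ⟨h1, h2⟩; by_cases hx : x = k
        · exact Or.inr hx
        · exact Or.inl ⟨h1, by omega⟩
      · rintro (⟨h1, h2⟩ | rfl)
        · exact ⟨h1, by omega⟩
        · exact ⟨h, by omega⟩
    · simp only [h, if_false, Finset.mem_filter, Finset.union_empty]
      constructor
      · rintro ⟨h1, h2⟩
        have : x ≠ k := fun e => h (e ▸ h1)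
        exact ⟨h1, by omega⟩
      · rintro ⟨h1, h2⟩; exact ⟨h1, by omega⟩
  rw [this, Finset.card_union_of_disjoint]
  · split_ifs <;> simp
  · split_ifs <;> simp

lemma stepSite_succ (A : Finset ℕ) (k : ℕ) :
    stepSite A (k + 1) = if k ∈ A then ((stepSite A k).1 + 1, (stepSite A k).2)
      else ((stepSite A k).1, (stepSite A k).2 + 1) := by
  have := card_filter_lt_le A k
  unfold stepSite
  rw [card_filter_lt_succ]
  split_ifs <;> ext <;> simp <;> omega

lemma filter_lt_eq_self {A : Finset ℕ} {n : ℕ} (h : A ⊆ Finset.range n) :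
    A.filter (· < n) = A :=
  Finset.filter_true_of_mem fun x hx => by simpa using h hx

lemma mem_stepPath {A : Finset ℕ} {n i j : ℕ} :
    (i, j) ∈ stepPath n A ↔
      1 ≤ i ∧ 1 ≤ j ∧ i + j ≤ n + 2 ∧ (A.filter (· < i + j - 2)).card = i - 1 := by
  simp only [stepPath, stepSite, Finset.mem_image, Finset.mem_range, Prod.mk.injEq]
  constructor
  · rintro ⟨k, hk, h1, h2⟩
    have := card_filter_lt_le A k
    have e : i + j - 2 = k := by omega
    rw [e]; omega
  · rintro ⟨h1, h2, h3, h4⟩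
    refine ⟨i + j - 2, by omega, by omega, by omega⟩

lemma stepPath_injOn (n : ℕ) :
    Set.InjOn (stepPath n) {A | A ⊆ Finset.range n} := by
  intro A hA B hB h
  have hc : ∀ k ≤ n, (A.filter (· < k)).card = (B.filter (· < k)).card := fun k hk => by
    have h1 : stepSite A k ∈ stepPath n B := by
      rw [← h]; exact Finset.mem_image_of_mem _ (by simp; omega)
    have := card_filter_lt_le A k
    have h2 := (mem_stepPath (i := (stepSite A k).1) (j := (stepSite A k).2)).1 h1
    have e : (stepSite A k).1 + (stepSite A k).2 - 2 = k := by simp only [stepSite]; omega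
    rw [e] at h2
    have h3 := h2.2.2.2
    simp only [stepSite] at h3
    omega
  ext k
  by_cases hk : k < n
  · have h1 := hc k hk.le
    have h2 := hc (k + 1) hk
    rw [card_filter_lt_succ, card_filter_lt_succ, h1] at h2
    by_cases a : k ∈ A <;> by_cases b : k ∈ B <;> simp_all
  · exact ⟨fun h => absurd (Finset.mem_range.1 (hA h)) hk,
      fun h => absurd (Finset.mem_range.1 (hB h)) hk⟩

lemma upRightPaths_eq_image (a b : ℕ) :
    upRightPaths (a + 1) (b + 1) =
      ((Finset.range (a + b)).powersetCard a).image (stepPath (a + b)) := by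
  classical
  ext s
  have e1 : a + 1 + (b + 1) - 2 = a + b := by omega
  have e2 : a + 1 + (b + 1) - 1 = a + b + 1 := by omega
  rw [upRightPaths, Finset.mem_filter, IsUpRightPath, e1, e2, Finset.mem_powerset]
  simp only [Finset.mem_image, Finset.mem_powersetCard]
  constructor
  · rintro ⟨-, c, h0, hn, hs, rfl⟩
    let A := (Finset.range (a + b)).filter fun k => c (k + 1) = ((c k).1 + 1, (c k).2)
    have hA : A ⊆ Finset.range (a + b) := Finset.filter_subset _ _
    have hc : ∀ k ≤ a + b, c k = stepSite A k := by
      intro k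
      induction k with
      | zero => intro _; simp [h0, stepSite]
      | succ k ih =>
        intro hk
        rw [stepSite_succ, ← ih (by omega)]
        by_cases hkA : k ∈ A
        · rw [if_pos hkA]; exact (Finset.mem_filter.1 hkA).2
        · rw [if_neg hkA]
          refine (hs k (by omega)).resolve_left fun h => hkA ?_
          exact Finset.mem_filter.2 ⟨by simp; omega, h⟩
    refine ⟨A, ⟨hA, ?_⟩, ?_⟩
    · have := hc _ le_rfl
      rw [hn, stepSite, filter_lt_eq_self hA, Prod.mk.injEq] at this
      omega
    · refine Finset.image_congr fun k hk => (hc k ?_).symm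
      simp at hk; omega
  · rintro ⟨A, ⟨hA, hcard⟩, rfl⟩
    have hn : stepSite A (a + b) = (a + 1, b + 1) := by
      rw [stepSite, filter_lt_eq_self hA, hcard]; ext <;> simp <;> omega
    refine ⟨?_, stepSite A, by simp [stepSite], hn, fun k _ => ?_, rfl⟩
    · rintro ⟨i, j⟩ h
      rw [mem_stepPath] at h
      have h3 : (A.filter (· < i + j - 2)).card ≤ a := hcard ▸ Finset.card_filter_le _ _
      have h4 : (A.filter (¬ · < i + j - 2)).card ≤ a + b - (i + j - 2) := by
        calc _ ≤ (Finset.Ico (i + j - 2) (a + b)).card := Finset.card_le_card fun x hx => by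
              simp only [Finset.mem_filter, not_lt] at hx
              have := Finset.mem_range.1 (hA hx.1)
              simp; omega
          _ = _ := by simp
      have h5 := Finset.card_filter_add_card_filter_not (s := A) (· < i + j - 2)
      simp only [box, Finset.mem_product, Finset.mem_Icc]
      omega
    · rw [stepSite_succ]
      split_ifs
      · exact Or.inl rfl
      · exact Or.inr rfl

lemma card_upRightPaths (a b : ℕ) :
    (upRightPaths (a + 1) (b + 1)).card = (a + b).choose a := by
  rw [upRightPaths_eq_image, Finset.card_image_of_injOn, Finset.card_powersetCard,
    Finset.card_range]
  intro A hA B hB h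
  exact stepPath_injOn _ (Finset.mem_powersetCard.1 hA).1 (Finset.mem_powersetCard.1 hB).1 h

lemma card_of_mem_upRightPaths {a b : ℕ} {s : Finset (ℕ × ℕ)}
    (hs : s ∈ upRightPaths (a + 1) (b + 1)) : s.card = a + b + 1 := by
  rw [upRightPaths_eq_image] at hs
  obtain ⟨A, -, rfl⟩ := Finset.mem_image.1 hs
  rw [stepPath, Finset.card_image_of_injective, Finset.card_range]
  intro k l h
  have h1 := card_filter_lt_le A k
  have h2 := card_filter_lt_le A l
  simp only [stepSite, Prod.mk.injEq] at h
  omega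

lemma card_filter_card_filter_lt_le (n a k r : ℕ) :
    (((Finset.range n).powersetCard a).filter
      fun A => (A.filter (· < k)).card = r).card ≤ k.choose r * (n - k).choose (a - r) := by
  have hcard : ((Finset.range k).powersetCard r ×ˢ
      (Finset.Ico k n).powersetCard (a - r)).card = k.choose r * (n - k).choose (a - r) := by
    simp
  rw [← hcard]
  refine Finset.card_le_card_of_injOn
    (fun A => (A.filter (· < k), A.filter (¬ · < k))) ?_ ?_
  · intro A hA
    simp only [Finset.coe_filter, Finset.mem_powersetCard, Set.mem_ofPred_eq] at hA
    simp only [Finset.coe_product, Set.mem_prod, Finset.mem_coe, Finset.mem_powersetCard]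
    have h5 := Finset.card_filter_add_card_filter_not (s := A) (· < k)
    refine ⟨⟨fun x hx => ?_, hA.2⟩, fun x hx => ?_, by omega⟩
    · simp at hx ⊢; exact hx.2
    · simp only [Finset.mem_filter] at hx
      have := Finset.mem_range.1 (hA.1.1 hx.1)
      simp; omega
  · intro A _ B _ h
    simp only [Prod.mk.injEq] at h
    rw [← Finset.filter_union_filter_not_eq (· < k) A, h.1, h.2,
      Finset.filter_union_filter_not_eq]

/-- The number of up-right paths through a given site. -/
noncomputable def pathsThrough (N M : ℕ) (s : ℕ × ℕ) : ℕ :=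
  ((upRightPaths N M).filter (s ∈ ·)).card

lemma pathsThrough_le (a b i j : ℕ) :
    pathsThrough (a + 1) (b + 1) (i, j) ≤
      (i + j - 2).choose (i - 1) * (a + b - (i + j - 2)).choose (a - (i - 1)) := by
  refine le_trans ?_ (card_filter_card_filter_lt_le (a + b) a (i + j - 2) (i - 1))
  rw [pathsThrough, upRightPaths_eq_image, Finset.filter_image]
  refine Finset.card_image_le.trans (Finset.card_le_card fun A hA => ?_)
  simp only [Finset.mem_filter] at hA ⊢
  exact ⟨hA.1, (mem_stepPath.1 hA.2).2.2.2⟩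

lemma sum_sq_pathsThrough_le (a b : ℕ) :
    ∑ s ∈ box (a + 1) (b + 1), (pathsThrough (a + 1) (b + 1) s : ℝ) ^ 2 ≤
      ((2 * (a + b) + 2).choose (2 * a + 1) : ℝ) / 2 := by
  rw [← sum_sq_choose_mul_choose, ← Finset.sum_product']
  let φ : ℕ × ℕ → (ℕ × ℕ) × ℕ × ℕ := fun s =>
    ((s.1 + s.2 - 2, a + b - (s.1 + s.2 - 2)), s.1 - 1, a - (s.1 - 1))
  have hφ : Set.InjOn φ (box (a + 1) (b + 1)) := by
    rintro ⟨i, j⟩ h ⟨i', j'⟩ h' e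
    simp only [box, Finset.coe_product, Set.mem_prod, Finset.mem_coe, Finset.mem_Icc] at h h'
    simp only [φ, Prod.mk.injEq] at e
    ext <;> simp <;> omega
  calc _ ≤ ∑ s ∈ box (a + 1) (b + 1),
        (((φ s).1.1.choose (φ s).2.1 : ℝ) * ((φ s).1.2.choose (φ s).2.2 : ℝ)) ^ 2 := by
        refine Finset.sum_le_sum fun s _ => ?_
        gcongr
        exact_mod_cast pathsThrough_le a b s.1 s.2
    _ = ∑ p ∈ (box (a + 1) (b + 1)).image φ,
        ((p.1.1.choose p.2.1 : ℝ) * (p.1.2.choose p.2.2 : ℝ)) ^ 2 := by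
        rw [Finset.sum_image hφ]
    _ ≤ _ := by
        refine Finset.sum_le_sum_of_subset_of_nonneg ?_ fun _ _ _ => by positivity
        intro p hp
        obtain ⟨⟨i, j⟩, hs, rfl⟩ := Finset.mem_image.1 hp
        simp only [box, Finset.mem_product, Finset.mem_Icc] at hs
        simp only [φ, Finset.mem_product, Finset.HasAntidiagonal.mem_antidiagonal]
        omega

/-- The probability that a uniformly random up-right path visits a given site. -/
noncomputable def visitProb (N M : ℕ) (s : ℕ × ℕ) : ℝ :=
  ((upRightPaths N M).card : ℝ)⁻¹ * pathsThrough N M s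

lemma visitProb_nonneg (N M : ℕ) (s : ℕ × ℕ) : 0 ≤ visitProb N M s := by
  unfold visitProb; positivity

lemma visitProb_le_one (N M : ℕ) (s : ℕ × ℕ) : visitProb N M s ≤ 1 := by
  unfold visitProb
  rw [inv_mul_eq_div]
  exact div_le_one_of_le₀ (by exact_mod_cast Finset.card_filter_le _ _) (by positivity)

/-- The expected overlap of two independent uniformly random up-right paths is at most of the order
of the square root of their length. -/
lemma sum_sq_visitProb_le {N M : ℕ} (hN : 1 ≤ N) (hM : 1 ≤ M) :
    (∑ s ∈ box N M, visitProb N M s ^ 2) ^ 2 * ((N : ℝ) * M) ≤ 8 * ((M + N - 1 : ℕ) : ℝ) ^ 3 := by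
  obtain ⟨a, rfl⟩ := Nat.exists_eq_add_of_le' hN
  obtain ⟨b, rfl⟩ := Nat.exists_eq_add_of_le' hM
  have h1 := sum_sq_pathsThrough_le a b
  have h2 := sq_choose_two_mul_add_two_le a b
  have hc : (0 : ℝ) < (a + b).choose a := by exact_mod_cast Nat.choose_pos (by omega)
  have e : ∑ s ∈ box (a + 1) (b + 1), visitProb (a + 1) (b + 1) s ^ 2 =
      (((a + b).choose a : ℝ) ^ 2)⁻¹ *
        ∑ s ∈ box (a + 1) (b + 1), (pathsThrough (a + 1) (b + 1) s : ℝ) ^ 2 := by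
    rw [Finset.mul_sum]
    refine Finset.sum_congr rfl fun s _ => ?_
    rw [visitProb, card_upRightPaths, mul_pow, inv_pow]
  rw [e, mul_pow, mul_assoc, inv_pow, inv_mul_le_iff₀ (by positivity)]
  have e3 : ((b + 1 + (a + 1) - 1 : ℕ) : ℝ) = a + b + 1 := by
    rw [show b + 1 + (a + 1) - 1 = a + b + 1 by omega]; push_cast; ring
  rw [e3]
  push_cast
  have h0 : 0 ≤ ∑ s ∈ box (a + 1) (b + 1), (pathsThrough (a + 1) (b + 1) s : ℝ) ^ 2 :=
    Finset.sum_nonneg fun _ _ => sq_nonneg _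
  generalize ((2 * (a + b) + 2).choose (2 * a + 1) : ℝ) / 2 = x at h1 h2
  generalize ∑ s ∈ box (a + 1) (b + 1), (pathsThrough (a + 1) (b + 1) s : ℝ) ^ 2 = y at h0 h1 ⊢
  generalize ((a + b).choose a : ℝ) = c at h2 ⊢
  calc y ^ 2 * (((a : ℝ) + 1) * (b + 1)) ≤ x ^ 2 * (((a : ℝ) + 1) * (b + 1)) := by gcongr
    _ ≤ _ := h2
    _ = _ := by ring

/-- The standard exponential distribution. -/
noncomputable def stdExp : Measure ℝ :=
  (volume.restrict (Set.Ioi 0)).withDensity fun x => ENNReal.ofReal (exp (-x))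

lemma lintegral_stdExp {f : ℝ → ENNReal} (hf : Measurable f) :
    ∫⁻ x, f x ∂stdExp = ∫⁻ x in Set.Ioi 0, ENNReal.ofReal (exp (-x)) * f x := by
  rw [stdExp, lintegral_withDensity_eq_lintegral_mul _ (by fun_prop) hf]
  rfl

lemma integral_stdExp (f : ℝ → ℝ) :
    ∫ x, f x ∂stdExp = ∫ x in Set.Ioi 0, exp (-x) * f x := by
  have h : (fun x : ℝ => ENNReal.ofReal (exp (-x))) =
      fun x => ((Real.toNNReal (exp (-x)) : NNReal) : ENNReal) := rfl
  rw [stdExp, h, integral_withDensity_eq_integral_smul (by fun_prop)]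
  refine integral_congr_ae (.of_forall fun x => ?_)
  simp [NNReal.smul_def, (exp_pos _).le]

lemma integrable_stdExp_iff (f : ℝ → ℝ) :
    Integrable f stdExp ↔ IntegrableOn (fun x => exp (-x) * f x) (Set.Ioi 0) := by
  have h : (fun x : ℝ => ENNReal.ofReal (exp (-x))) =
      fun x => ((Real.toNNReal (exp (-x)) : NNReal) : ENNReal) := rfl
  rw [stdExp, h, integrable_withDensity_iff_integrable_smul (by fun_prop), IntegrableOn]
  refine integrable_congr (.of_forall fun x => ?_)
  simp [NNReal.smul_def, (exp_pos _).le]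

instance : IsProbabilityMeasure stdExp := by
  constructor
  rw [← lintegral_one, lintegral_stdExp measurable_const]
  simp only [mul_one]
  rw [← ofReal_integral_eq_lintegral_ofReal]
  · rw [integral_exp_neg_Ioi_zero, ENNReal.ofReal_one]
  · simpa [IntegrableOn] using integrableOn_exp_mul_Ioi (a := -1) (by norm_num) 0
  · exact .of_forall fun x => (exp_pos _).le

lemma integrable_exp_mul_stdExp {s : ℝ} (hs : s < 1) :
    Integrable (fun x => exp (s * x)) stdExp := by
  rw [integrable_stdExp_iff]
  convert integrableOn_exp_mul_Ioi (a := s - 1) (by linarith) 0 using 2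
  rw [← exp_add]; ring_nf

lemma integral_exp_mul_stdExp {s : ℝ} (hs : s < 1) :
    ∫ x, exp (s * x) ∂stdExp = (1 - s)⁻¹ := by
  rw [integral_stdExp]
  have : ∀ x : ℝ, exp (-x) * exp (s * x) = exp ((s - 1) * x) := fun x => by
    rw [← exp_add]; ring_nf
  simp_rw [this]
  rw [integral_exp_mul_Ioi (by linarith)]
  simp
  rw [← neg_div_neg_eq]; simp

lemma integrable_rpow_stdExp {p : ℝ} (hp : -1 < p) :
    IntegrableOn (fun x : ℝ => exp (-x) * x ^ p) (Set.Ioi 0) := by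
  simpa using GammaIntegral_convergent (s := p + 1) (by linarith)

lemma integrable_pow_stdExp (k : ℕ) : Integrable (fun x => x ^ k) stdExp := by
  rw [integrable_stdExp_iff]
  have := integrable_rpow_stdExp (p := k) (by linarith [Nat.cast_nonneg (α := ℝ) k])
  simpa using this

lemma integral_pow_stdExp (k : ℕ) : ∫ x, x ^ k ∂stdExp = k.factorial := by
  rw [integral_stdExp, ← Real.Gamma_nat_eq_factorial, Real.Gamma_eq_integral (by positivity)]
  simp

lemma integral_id_stdExp : ∫ x, x ∂stdExp = 1 := by
  simpa using integral_pow_stdExp 1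

/-- A Lipschitz function of an exponential variable is sub-Gaussian near the origin. -/
lemma integral_exp_stdExp_le {G : ℝ → ℝ} {c B : ℝ} (hc0 : 0 ≤ c) (hc : c ≤ 1 / 2)
    (hB : ∀ x, |G x| ≤ B) (hG : ∀ x y, |G x - G y| ≤ c * |x - y|) :
    ∫ x, exp (G x) ∂stdExp ≤ exp (∫ x, G x ∂stdExp + 2 * c ^ 2) := by
  have hcont : Continuous G := by
    refine (LipschitzWith.of_dist_le_mul (K := c.toNNReal) fun x y => ?_).continuous
    simpa [Real.dist_eq, hc0] using hG x y
  have hbdd : ∀ g : ℝ → ℝ, Continuous g → ∀ C, (∀ x, |g x| ≤ C) → Integrable g stdExp :=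
    fun g hg C hC => .of_bound hg.aestronglyMeasurable C (.of_forall hC)
  have hIG := hbdd G hcont B hB
  have hI1 : Integrable (fun x => exp (G x)) stdExp :=
    hbdd _ (by fun_prop) (exp B) fun x => by
      rw [abs_of_pos (exp_pos _)]; exact exp_le_exp.2 ((le_abs_self _).trans (hB x))
  have hI2 : Integrable (fun x => exp (-G x)) stdExp :=
    hbdd _ (by fun_prop) (exp B) fun x => by
      rw [abs_of_pos (exp_pos _)]; exact exp_le_exp.2 ((neg_le_abs _).trans (hB x))
  have hJ : exp (-∫ x, G x ∂stdExp) ≤ ∫ x, exp (-G x) ∂stdExp := by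
    rw [← integral_neg]
    exact convexOn_exp.map_integral_le continuous_exp.continuousOn isClosed_univ
      (.of_forall fun _ => Set.mem_univ _) hIG.neg hI2
  have hE1 := integrable_exp_mul_stdExp (s := c) (by linarith)
  have hE2 := integrable_exp_mul_stdExp (s := -c) (by linarith)
  have key : (∫ x, exp (G x) ∂stdExp) * ∫ x, exp (-G x) ∂stdExp ≤
      (∫ x, exp (c * x) ∂stdExp) * ∫ x, exp (-c * x) ∂stdExp := by
    have a1 := hI1.mul_prod hI2
    have a2 := hI2.mul_prod hI1
    have b1 := hE1.mul_prod hE2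
    have b2 := hE2.mul_prod hE1
    have h2 : 2 * ((∫ x, exp (G x) ∂stdExp) * ∫ x, exp (-G x) ∂stdExp) ≤
        2 * ((∫ x, exp (c * x) ∂stdExp) * ∫ x, exp (-c * x) ∂stdExp) := by
      calc _ = ∫ z : ℝ × ℝ, (exp (G z.1) * exp (-G z.2) + exp (-G z.1) * exp (G z.2))
            ∂(stdExp.prod stdExp) := by
            rw [integral_add a1 a2, integral_prod_mul (fun x => exp (G x)) fun x => exp (-G x),
              integral_prod_mul (fun x => exp (-G x)) fun x => exp (G x)]; ring
        _ ≤ ∫ z : ℝ × ℝ, (exp (c * z.1) * exp (-c * z.2) + exp (-c * z.1) * exp (c * z.2))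
            ∂(stdExp.prod stdExp) := by
            refine integral_mono (a1.add a2) (b1.add b2) fun z => ?_
            have e : ∀ u v : ℝ, exp u * exp (-v) + exp (-u) * exp v = 2 * cosh (u - v) := by
              intro u v
              rw [cosh_eq, ← exp_add, ← exp_add]; ring_nf
            have e' : ∀ u v : ℝ, exp (c * u) * exp (-c * v) + exp (-c * u) * exp (c * v) =
                2 * cosh (c * (u - v)) := by
              intro u v
              rw [cosh_eq, ← exp_add, ← exp_add]; ring_nf
            simp only [e, e']
            have : cosh (G z.1 - G z.2) ≤ cosh (c * (z.1 - z.2)) := by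
              rw [cosh_le_cosh, abs_mul, abs_of_nonneg hc0]; exact hG _ _
            linarith
        _ = _ := by 
            rw [integral_add b1 b2, integral_prod_mul (fun x => exp (c * x)) fun x => exp (-c * x),
              integral_prod_mul (fun x => exp (-c * x)) fun x => exp (c * x)]; ring
    linarith
  rw [integral_exp_mul_stdExp (by linarith), integral_exp_mul_stdExp (by linarith)] at key
  have hc2 : (1 - c)⁻¹ * (1 - -c)⁻¹ ≤ exp (2 * c ^ 2) := by
    have h1 : 1 - 2 * c ^ 2 + 2 * c ^ 4 ≥ 0 := by nlinarith [sq_nonneg (c^2)]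
    have h2 := add_one_le_exp (2 * c ^ 2)
    rw [← mul_inv, inv_le_iff_one_le_mul₀ (by nlinarith)]
    have : (1 - c) * (1 - -c) = 1 - c ^ 2 := by ring
    rw [this]
    have h4 : c ^ 2 ≤ 1 / 4 := by nlinarith
    nlinarith [sq_nonneg c]
  have hpos : 0 < ∫ x, exp (G x) ∂stdExp := integral_exp_pos hI1
  have := (mul_le_mul_of_nonneg_left hJ hpos.le).trans (key.trans hc2)
  rw [exp_neg, ← div_eq_mul_inv, div_le_iff₀ (exp_pos _), ← exp_add] at this
  rwa [add_comm]

lemma continuous_of_abs_sub_le_sum {ι : Type*} [Fintype ι] {F : (ι → ℝ) → ℝ} {c : ι → ℝ}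
    (hF : ∀ x y, |F x - F y| ≤ ∑ i, c i * |x i - y i|) : Continuous F := by
  rw [continuous_iff_continuousAt]
  intro x
  rw [ContinuousAt, tendsto_iff_dist_tendsto_zero]
  refine squeeze_zero (fun _ => dist_nonneg) (fun y => hF y x) ?_
  have : Continuous fun y : ι → ℝ => ∑ i, c i * |y i - x i| := by fun_prop
  simpa using this.tendsto x

lemma integral_exp_pi_stdExp_le {ι : Type} [Fintype ι] :
    ∀ (F : (ι → ℝ) → ℝ) (c : ι → ℝ) (B : ℝ), (∀ i, 0 ≤ c i) → (∀ i, c i ≤ 1 / 2) →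
      (∀ x, |F x| ≤ B) → (∀ x y, |F x - F y| ≤ ∑ i, c i * |x i - y i|) →
      ∫ x, exp (F x) ∂(Measure.pi fun _ : ι => stdExp) ≤
        exp (∫ x, F x ∂(Measure.pi fun _ : ι => stdExp) + 2 * ∑ i, c i ^ 2) := by
  refine @Fintype.induction_empty_option
    (fun ι _ => ∀ (F : (ι → ℝ) → ℝ) (c : ι → ℝ) (B : ℝ), (∀ i, 0 ≤ c i) → (∀ i, c i ≤ 1 / 2) →
      (∀ x, |F x| ≤ B) → (∀ x y, |F x - F y| ≤ ∑ i, c i * |x i - y i|) →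
      ∫ x, exp (F x) ∂(Measure.pi fun _ : ι => stdExp) ≤
        exp (∫ x, F x ∂(Measure.pi fun _ : ι => stdExp) + 2 * ∑ i, c i ^ 2)) ?_ ?_ ?_ ι _
  · intro α β _ e ih F c B hc0 hc hB hF
    let _ := Fintype.ofEquiv β e.symm
    have hmp : MeasurePreserving (MeasurableEquiv.piCongrLeft (fun _ : β => ℝ) e)
        (Measure.pi fun _ : α => stdExp) (Measure.pi fun _ : β => stdExp) :=
      measurePreserving_piCongrLeft (fun _ : β => stdExp) e
    have h := ih (fun x => F (MeasurableEquiv.piCongrLeft (fun _ : β => ℝ) e x))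
      (fun a => c (e a)) B (fun _ => hc0 _) (fun _ => hc _) (fun _ => hB _) fun x y => by
        refine (hF _ _).trans (le_of_eq ?_)
        rw [← e.sum_comp]
        simp [MeasurableEquiv.coe_piCongrLeft, Equiv.piCongrLeft_apply_apply]
    rw [hmp.integral_comp' (g := fun x => exp (F x)), hmp.integral_comp' (g := F),
      e.sum_comp (fun i => c i ^ 2)] at h
    exact h
  · intro F c B _ _ _ _
    rw [Measure.pi_of_empty]
    simp
  · intro α _ ih F c B hc0 hc hB hF
    have hmp : MeasurePreserving (MeasurableEquiv.piOptionEquivProd (fun _ : Option α => ℝ)).symm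
        ((Measure.pi fun _ : α => stdExp).prod stdExp) (Measure.pi fun _ : Option α => stdExp) :=
      ⟨by fun_prop, Measure.pi_map_piOptionEquivProd (fun _ : Option α => stdExp)⟩
    let J : (α → ℝ) × ℝ → Option α → ℝ := fun p =>
      (MeasurableEquiv.piOptionEquivProd (fun _ : Option α => ℝ)).symm p
    have J1 : ∀ z x, J (z, x) none = x := fun z x => rfl
    have J2 : ∀ z x i, J (z, x) (some i) = z i := fun z x i => rfl
    have hFc := continuous_of_abs_sub_le_sum hF
    have hJc : Measurable J := hmp.measurable
    have hbdd : ∀ {X : Type} [MeasurableSpace X] (m : Measure X) [IsProbabilityMeasure m]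
        (g : X → ℝ), Measurable g → ∀ C, (∀ x, |g x| ≤ C) → Integrable g m :=
      fun m _ g hg C hC => .of_bound hg.aestronglyMeasurable C (.of_forall hC)
    have hexp : ∀ u, |u| ≤ B → |exp u| ≤ exp B := fun u hu => by
      rw [abs_of_pos (exp_pos _)]; exact exp_le_exp.2 ((le_abs_self _).trans hu)
    set H : (α → ℝ) → ℝ := fun z => ∫ x, F (J (z, x)) ∂stdExp with hH
    have hI : ∀ z, Integrable (fun x => F (J (z, x))) stdExp := fun z =>
      hbdd _ _ (by fun_prop) B fun x => hB _
    have hHB : ∀ z, |H z| ≤ B := fun z => by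
      simpa using norm_integral_le_of_norm_le_const (μ := stdExp) (f := fun x => F (J (z, x)))
        (.of_forall fun x => hB _)
    have hHL : ∀ z y, |H z - H y| ≤ ∑ i, c (some i) * |z i - y i| := fun z y => by
      rw [hH]
      simp only
      rw [← integral_sub (hI z) (hI y)]
      have := norm_integral_le_of_norm_le_const (μ := stdExp)
        (f := fun x => F (J (z, x)) - F (J (y, x))) (C := ∑ i, c (some i) * |z i - y i|)
        (.of_forall fun x => by simpa [J1, J2] using hF (J (z, x)) (J (y, x)))
      simpa using this
    have hHm : Continuous H := continuous_of_abs_sub_le_sum hHL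
    have h1 : ∀ z, ∫ x, exp (F (J (z, x))) ∂stdExp ≤ exp (H z + 2 * c none ^ 2) := fun z =>
      integral_exp_stdExp_le (hc0 none) (hc none) (fun _ => hB _)
        fun x y => by simpa [J1, J2] using hF (J (z, x)) (J (z, y))
    have h2 := ih H (fun i => c (some i)) B (fun _ => hc0 _) (fun _ => hc _) hHB hHL
    rw [← hmp.integral_comp' (g := fun x => exp (F x)), ← hmp.integral_comp' (g := F)]
    have hm1 : Integrable (fun p => F (J p)) ((Measure.pi fun _ : α => stdExp).prod stdExp) :=
      hbdd _ _ (by fun_prop) B fun x => hB _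
    have hm2 : Integrable (fun p => exp (F (J p)))
        ((Measure.pi fun _ : α => stdExp).prod stdExp) :=
      hbdd _ _ (by fun_prop) (exp B) fun x => hexp _ (hB _)
    change ∫ p, exp (F (J p)) ∂_ ≤ exp (∫ p, F (J p) ∂_ + _)
    rw [integral_prod _ hm1, integral_prod _ hm2]
    calc _ ≤ ∫ z, exp (H z + 2 * c none ^ 2) ∂(Measure.pi fun _ : α => stdExp) := by
          refine integral_mono hm2.integral_prod_left ?_ h1
          refine hbdd _ _ (by fun_prop) (exp (B + 2 * c none ^ 2)) fun z => ?_
          rw [abs_of_pos (exp_pos _)]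
          exact exp_le_exp.2 (by linarith [(le_abs_self _).trans (hHB z)])
      _ = (∫ z, exp (H z) ∂(Measure.pi fun _ : α => stdExp)) * exp (2 * c none ^ 2) := by
          simp_rw [exp_add]
          rw [integral_mul_const]
      _ ≤ _ := by
          refine (mul_le_mul_of_nonneg_right h2 (exp_pos _).le).trans (le_of_eq ?_)
          rw [← exp_add, Fintype.sum_option]
          simp only [hH]
          ring_nf

/-- Exponential concentration for Lipschitz functions of independent exponential variables. -/
lemma measure_pi_stdExp_abs_sub_ge_le {ι : Type} [Fintype ι] {F : (ι → ℝ) → ℝ} {c : ι → ℝ} {B : ℝ}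
    (hc0 : ∀ i, 0 ≤ c i) (hB : ∀ x, |F x| ≤ B)
    (hF : ∀ x y, |F x - F y| ≤ ∑ i, c i * |x i - y i|) {l : ℝ} (hl : 0 < l)
    (hlc : ∀ i, l * c i ≤ 1 / 2) (ε : ℝ) :
    (Measure.pi fun _ : ι => stdExp).real
        {x | ε ≤ |F x - ∫ y, F y ∂(Measure.pi fun _ : ι => stdExp)|} ≤
      2 * exp (-(l * ε) + 2 * l ^ 2 * ∑ i, c i ^ 2) := by
  set μ := Measure.pi fun _ : ι => stdExp with hμ
  have hFc := continuous_of_abs_sub_le_sum hF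
  set m := ∫ y, F y ∂μ with hm
  have one : ∀ s : ℝ, |s| = l →
      μ.real {x | l * ε ≤ s * (F x - m)} ≤ exp (-(l * ε) + 2 * l ^ 2 * ∑ i, c i ^ 2) := by
    intro s hs
    have hint : Integrable (fun x => exp (s * F x - s * m)) μ := by
      refine .of_bound (by fun_prop) (exp (l * B - s * m)) (.of_forall fun x => ?_)
      rw [norm_of_nonneg (exp_pos _).le]
      refine exp_le_exp.2 (sub_le_sub_right ((le_abs_self _).trans ?_) _)
      rw [abs_mul, hs]
      exact mul_le_mul_of_nonneg_left (hB x) hl.le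
    have h1 := integral_exp_pi_stdExp_le (fun x => s * F x) (fun i => l * c i) (l * B)
      (fun i => mul_nonneg hl.le (hc0 i)) hlc
      (fun x => by rw [abs_mul, hs]; exact mul_le_mul_of_nonneg_left (hB x) hl.le)
      (fun x y => by
        rw [← mul_sub, abs_mul, hs]
        refine (mul_le_mul_of_nonneg_left (hF x y) hl.le).trans (le_of_eq ?_)
        rw [Finset.mul_sum]
        exact Finset.sum_congr rfl fun i _ => by ring)
    rw [← hμ, integral_const_mul, ← hm] at h1
    have h2 : ∫ x, exp (s * F x - s * m) ∂μ ≤ exp (2 * l ^ 2 * ∑ i, c i ^ 2) := by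
      simp_rw [sub_eq_add_neg, exp_add]
      rw [integral_mul_const]
      refine (mul_le_mul_of_nonneg_right h1 (exp_pos _).le).trans (le_of_eq ?_)
      rw [← exp_add]
      simp_rw [mul_pow]
      rw [← Finset.mul_sum]
      ring_nf
    have h3 := mul_meas_ge_le_integral_of_nonneg (μ := μ)
      (.of_forall fun x => (exp_pos (s * F x - s * m)).le) hint (exp (l * ε))
    have h4 : {x | l * ε ≤ s * (F x - m)} = {x | exp (l * ε) ≤ exp (s * F x - s * m)} := by
      ext x; simp [mul_sub]
    rw [h4, exp_add, exp_neg, inv_mul_eq_div, le_div_iff₀ (exp_pos _), mul_comm]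
    exact h3.trans h2
  calc _ ≤ μ.real ({x | l * ε ≤ l * (F x - m)} ∪ {x | l * ε ≤ -l * (F x - m)}) := by
        refine measureReal_mono fun x hx => ?_
        rcases abs_cases (F x - m) with h | h <;> simp only [Set.mem_ofPred_eq, h.1] at hx
        · left; exact mul_le_mul_of_nonneg_left hx hl.le
        · right
          simp only [Set.mem_ofPred_eq, neg_mul_comm]
          exact mul_le_mul_of_nonneg_left hx hl.le
    _ ≤ _ := measureReal_union_le _ _
    _ ≤ _ := by
        have := one l (abs_of_pos hl)
        have := one (-l) (by rw [abs_neg, abs_of_pos hl])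
        linarith

/-- The law of the normalized sum of `L` independent centered exponential variables. -/
noncomputable def expSumLaw (L : ℕ) : Measure ℝ :=
  (Measure.pi fun _ : Fin L => stdExp).map fun x => (√L)⁻¹ * ∑ i, (x i - 1)

instance (L : ℕ) : IsProbabilityMeasure (expSumLaw L) :=
  Measure.isProbabilityMeasure_map
    (Measurable.const_mul (f := fun x : Fin L → ℝ => ∑ i, (x i - 1)) (by fun_prop) _).aemeasurable

lemma measurable_sum_ite_sub_one {ι : Type} [Fintype ι] (p : ι → Prop) [DecidablePred p] :
    Measurable fun x : ι → ℝ => ∑ i, if p i then x i - 1 else 0 := by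
  refine Finset.measurable_sum _ fun i _ => ?_
  split_ifs <;> fun_prop

lemma charFun_map_sum_stdExp {ι : Type} [Fintype ι] (p : ι → Prop) [DecidablePred p] (r t : ℝ) :
    charFun ((Measure.pi fun _ : ι => stdExp).map
      fun x => r * ∑ i, if p i then x i - 1 else 0) t =
      charFun (stdExp.map fun x => x - 1) (r * t) ^ (Finset.univ.filter p).card := by
  have hm : ∀ i, Measurable fun x : ℝ => if p i then x - 1 else 0 := fun i => by
    split_ifs <;> fun_prop
  have hp : ∀ i, IsProbabilityMeasure (stdExp.map fun x : ℝ => if p i then x - 1 else 0) :=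
    fun i => Measure.isProbabilityMeasure_map (hm i).aemeasurable
  have e : ((Measure.pi fun _ : ι => stdExp).map
      fun x => ∑ i, if p i then x i - 1 else 0) =
      (Measure.pi fun i => stdExp.map fun x : ℝ => if p i then x - 1 else 0).map
        fun x => ∑ i, x i := by
    have hm' : Measurable fun (x : ι → ℝ) i => if p i then x i - 1 else 0 :=
      measurable_pi_lambda _ fun i => (hm i).comp (measurable_pi_apply i)
    rw [← Measure.pi_map_pi fun i => (hm i).aemeasurable, Measure.map_map (by fun_prop) hm']
    rfl
  rw [charFun_map_mul_comp (measurable_sum_ite_sub_one p).aemeasurable, e, charFun_map_sum_pi_eq_prod, Finset.prod_apply]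
  have : ∀ i, charFun (stdExp.map fun x : ℝ => if p i then x - 1 else 0) (r * t) =
      if p i then charFun (stdExp.map fun x => x - 1) (r * t) else 1 := fun i => by
    split_ifs <;> simp
  simp_rw [this]
  rw [Finset.prod_ite]
  simp

lemma map_sum_stdExp_eq_expSumLaw {ι : Type} [Fintype ι] (p : ι → Prop) [DecidablePred p] :
    ((Measure.pi fun _ : ι => stdExp).map
      fun x => (√((Finset.univ.filter p).card : ℝ))⁻¹ * ∑ i, if p i then x i - 1 else 0) =
      expSumLaw (Finset.univ.filter p).card := by
  have : IsProbabilityMeasure ((Measure.pi fun _ : ι => stdExp).map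
      fun x => (√((Finset.univ.filter p).card : ℝ))⁻¹ * ∑ i, if p i then x i - 1 else 0) :=
    Measure.isProbabilityMeasure_map ((measurable_sum_ite_sub_one p).const_mul _).aemeasurable
  refine Measure.ext_of_charFun ?_
  ext t
  rw [charFun_map_sum_stdExp]
  generalize (Finset.univ.filter p).card = L
  have := charFun_map_sum_stdExp (fun _ : Fin L => True) (√L)⁻¹ t
  simpa [expSumLaw] using this.symm

lemma tendsto_integral_expSumLaw {f : ℝ → ℝ} {B : ℝ} (hf : Continuous f) (hB : ∀ x, |f x| ≤ B) :
    Tendsto (fun L => ∫ x, f x ∂expSumLaw L) atTop (nhds (∫ x, f x ∂gaussianReal 0 1)) := by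
  let ν : ℕ → ProbabilityMeasure ℝ := fun L => ⟨expSumLaw L, inferInstance⟩
  let γ : ProbabilityMeasure ℝ := ⟨gaussianReal 0 1, inferInstance⟩
  have h : Tendsto ν atTop (nhds γ) := by
    refine ProbabilityMeasure.tendsto_iff_tendsto_charFun.2 fun t => ?_
    have i1 : Integrable (fun x : ℝ => x) stdExp := by simpa using integrable_pow_stdExp 1
    have i2 := integrable_pow_stdExp 2
    have h0 : ∫ x, (x - 1) ∂stdExp = 0 := by
      rw [integral_sub i1 (integrable_const _), integral_id_stdExp]; simp
    have h1 : ∫ x, (x - 1) ^ 2 ∂stdExp = 1 := by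
      have : ∀ x : ℝ, (x - 1) ^ 2 = x ^ 2 - 2 * x + 1 := fun x => by ring
      simp_rw [this]
      rw [integral_add (f := fun x : ℝ => x ^ 2 - 2 * x) (i2.sub (i1.const_mul 2)) (integrable_const _),
        integral_sub i2 (i1.const_mul 2), integral_const_mul, integral_id_stdExp,
        integral_pow_stdExp]
      simp
    have := tendsto_charFun_inv_sqrt_mul_pow (P := stdExp) (X := fun x => x - 1)
      (by fun_prop) h0 h1 t
    have e : ∀ L : ℕ, charFun (expSumLaw L) t =
        charFun (stdExp.map fun x => x - 1) ((√L)⁻¹ * t) ^ L := fun L => by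
      have := charFun_map_sum_stdExp (fun _ : Fin L => True) (√L)⁻¹ t
      simpa [expSumLaw] using this
    simp only [ν, γ, ProbabilityMeasure.coe_mk, e, charFun_gaussianReal]
    simpa [neg_div] using this
  have := (ProbabilityMeasure.tendsto_iff_forall_integral_tendsto.1 h)
    (BoundedContinuousFunction.ofNormedAddCommGroup f hf B hB)
  exact this

lemma upRightPaths_card_pos {N M : ℕ} (hN : 1 ≤ N) (hM : 1 ≤ M) : 0 < (upRightPaths N M).card := by
  obtain ⟨a, rfl⟩ := Nat.exists_eq_add_of_le' hN
  obtain ⟨b, rfl⟩ := Nat.exists_eq_add_of_le' hM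
  rw [card_upRightPaths]
  exact Nat.choose_pos (by omega)

lemma card_filter_mem_upRightPath {N M : ℕ} (hN : 1 ≤ N) (hM : 1 ≤ M) {s : Finset (ℕ × ℕ)}
    (hs : s ∈ upRightPaths N M) :
    (Finset.univ.filter fun a : ↥(box N M) => (a : ℕ × ℕ) ∈ s).card = M + N - 1 := by
  have hsub : s ⊆ box N M := by
    classical
    rw [upRightPaths, Finset.mem_filter] at hs
    exact Finset.mem_powerset.1 hs.1
  obtain ⟨a, rfl⟩ := Nat.exists_eq_add_of_le' hN
  obtain ⟨b, rfl⟩ := Nat.exists_eq_add_of_le' hM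
  have h := card_of_mem_upRightPaths hs
  rw [show b + 1 + (a + 1) - 1 = s.card by omega, ← Finset.card_map (Function.Embedding.subtype _)]
  congr 1
  ext x
  simp only [Finset.mem_map, Finset.mem_filter, Finset.mem_univ, true_and,
    Function.Embedding.subtype_apply, Subtype.exists, exists_and_left, exists_prop, exists_eq_right_right]
  exact ⟨fun h => h.1, fun h => ⟨h, hsub h⟩⟩

lemma abs_pathAvgCentered_le {N M : ℕ} (W V : ↥(box N M) → ℝ) {f : ℝ → ℝ} {B : ℝ} (hB0 : 0 ≤ B)
    (hB : ∀ x, |f x| ≤ B) : |pathAvgCentered N M W V f| ≤ B := by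
  rw [pathAvgCentered, abs_mul, abs_of_nonneg (by positivity), inv_mul_eq_div]
  refine div_le_of_le_mul₀ (by positivity) hB0 ((Finset.abs_sum_le_sum_abs _ _).trans ?_)
  refine (Finset.sum_le_sum fun s _ => hB _).trans ?_
  simp [mul_comm]

/-- The average over up-right paths is Lipschitz in each weight, with constant proportional to the
probability of visiting the corresponding site. -/
lemma abs_pathAvgCentered_sub_le {N M : ℕ} (V x y : ↥(box N M) → ℝ) {f : ℝ → ℝ}
    (hf : LipschitzWith 1 f) :
    |pathAvgCentered N M x V f - pathAvgCentered N M y V f| ≤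
      ∑ a : ↥(box N M), ((√((M + N - 1 : ℕ) : ℝ))⁻¹ * visitProb N M a) * |x a - y a| := by
  set r := (√((M + N - 1 : ℕ) : ℝ))⁻¹ with hr
  have hr0 : 0 ≤ r := by positivity
  have h1 : ∀ s : Finset (ℕ × ℕ),
      |f (r * ∑ a : ↥(box N M), if (a : ℕ × ℕ) ∈ s then x a - V a else 0) -
        f (r * ∑ a : ↥(box N M), if (a : ℕ × ℕ) ∈ s then y a - V a else 0)| ≤
      ∑ a : ↥(box N M), if (a : ℕ × ℕ) ∈ s then r * |x a - y a| else 0 := by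
    intro s
    have := hf.dist_le_mul
      (r * ∑ a : ↥(box N M), if (a : ℕ × ℕ) ∈ s then x a - V a else 0)
      (r * ∑ a : ↥(box N M), if (a : ℕ × ℕ) ∈ s then y a - V a else 0)
    rw [NNReal.coe_one, one_mul, Real.dist_eq, Real.dist_eq] at this
    refine this.trans ?_
    rw [← mul_sub, ← Finset.sum_sub_distrib, Finset.mul_sum]
    refine (Finset.abs_sum_le_sum_abs _ _).trans (Finset.sum_le_sum fun a _ => ?_)
    split_ifs
    · rw [abs_mul, abs_of_nonneg hr0]; simp
    · simp
  rw [pathAvgCentered, pathAvgCentered, ← hr, ← mul_sub, ← Finset.sum_sub_distrib, abs_mul,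
    abs_of_nonneg (by positivity)]
  calc _ ≤ ((upRightPaths N M).card : ℝ)⁻¹ * ∑ s ∈ upRightPaths N M,
        ∑ a : ↥(box N M), if (a : ℕ × ℕ) ∈ s then r * |x a - y a| else 0 := by
        gcongr
        exact (Finset.abs_sum_le_sum_abs _ _).trans (Finset.sum_le_sum fun s _ => h1 s)
    _ = _ := by
        rw [Finset.sum_comm, Finset.mul_sum]
        refine Finset.sum_congr rfl fun a _ => ?_
        rw [← Finset.sum_filter, Finset.sum_const, nsmul_eq_mul, visitProb, pathsThrough]
        ring

lemma integral_pathAvgCentered_stdExp {N M : ℕ} (hN : 1 ≤ N) (hM : 1 ≤ M) {f : ℝ → ℝ} {B : ℝ}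
    (hf : Continuous f) (hB : ∀ x, |f x| ≤ B) :
    ∫ x, pathAvgCentered N M x (fun _ => 1) f ∂(Measure.pi fun _ : ↥(box N M) => stdExp) =
      ∫ x, f x ∂expSumLaw (M + N - 1) := by
  have hm : ∀ s : Finset (ℕ × ℕ), Measurable fun x : ↥(box N M) → ℝ =>
      (√((M + N - 1 : ℕ) : ℝ))⁻¹ * ∑ a : ↥(box N M), if (a : ℕ × ℕ) ∈ s then x a - 1 else 0 :=
    fun s => (measurable_sum_ite_sub_one _).const_mul _
  unfold pathAvgCentered
  rw [integral_const_mul, integral_finsetSum]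
  swap
  · exact fun s _ => .of_bound (hf.measurable.comp (hm s)).aestronglyMeasurable B
      (.of_forall fun x => hB _)
  have h1 : ∀ s ∈ upRightPaths N M, ∫ x : ↥(box N M) → ℝ, f ((√((M + N - 1 : ℕ) : ℝ))⁻¹ *
      ∑ a : ↥(box N M), if (a : ℕ × ℕ) ∈ s then x a - 1 else 0) ∂(Measure.pi fun _ => stdExp) =
      ∫ x, f x ∂expSumLaw (M + N - 1) := by
    intro s hs
    rw [← integral_map (hm s).aemeasurable hf.aestronglyMeasurable]
    have := map_sum_stdExp_eq_expSumLaw fun a : ↥(box N M) => (a : ℕ × ℕ) ∈ s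
    rw [card_filter_mem_upRightPath hN hM hs] at this
    rw [this]
  rw [Finset.sum_congr rfl h1, Finset.sum_const, nsmul_eq_mul, inv_mul_cancel_left₀]
  exact_mod_cast (upRightPaths_card_pos hN hM).ne'

lemma summable_exp_neg_mul_sqrt_sqrt {ε : ℝ} (hε : 0 < ε) (C : ℝ) :
    Summable fun N : ℕ => 2 * exp (-(√√(N : ℝ) * ε) + C) := by
  refine Summable.mul_left _ ?_
  simp_rw [exp_add]
  refine Summable.mul_right _ ?_
  refine Summable.of_norm_bounded_eventually_nat
    ((Real.summable_nat_pow_inv.2 one_lt_two).mul_left (Nat.factorial 8 / ε ^ 8 : ℝ)) ?_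
  filter_upwards [eventually_ge_atTop 1] with N hN
  rw [norm_of_nonneg (exp_pos _).le]
  have hN' : (0 : ℝ) < N := by exact_mod_cast hN
  have h := Real.pow_div_factorial_le_exp (√√(N : ℝ) * ε) (by positivity) 8
  have e : (√√(N : ℝ) * ε) ^ 8 = (N : ℝ) ^ 2 * ε ^ 8 := by
    have h1 : √√(N : ℝ) ^ 2 = √N := Real.sq_sqrt (by positivity)
    have h2 : √(N : ℝ) ^ 2 = N := Real.sq_sqrt (by positivity)
    calc _ = (((√√(N : ℝ)) ^ 2) ^ 2) ^ 2 * ε ^ 8 := by ring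
      _ = _ := by rw [h1, h2]
  rw [e] at h
  rw [exp_neg, inv_le_comm₀ (exp_pos _) (by positivity)]
  refine le_trans (le_of_eq ?_) h
  field_simp

/-- The quenched law for independent exponential weights concentrates around the standard Gaussian
law at a summable rate. -/
lemma exists_summable_measure_pathAvgCentered_le {ξ : ℝ} (hξ : 0 < ξ) {f : ℝ → ℝ} {B : ℝ}
    (hf : LipschitzWith 1 f) (hB : ∀ x, |f x| ≤ B) {ε : ℝ} (hε : 0 < ε) :
    ∃ u : ℕ → ℝ, Summable u ∧ ∀ᶠ N : ℕ in atTop, ∀ M : ℕ, M = ⌊ξ * (N : ℝ)⌋₊ →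
      (Measure.pi fun _ : ↥(box N M) => stdExp).real
        {x | ε ≤ |pathAvgCentered N M x (fun _ => 1) f - ∫ x, f x ∂gaussianReal 0 1|} ≤ u N := by
  have hB0 : 0 ≤ B := (abs_nonneg _).trans (hB 0)
  set C := √(16 * (1 + ξ) / ξ) with hC
  refine ⟨_, summable_exp_neg_mul_sqrt_sqrt (half_pos hε) (2 * C), ?_⟩
  have hL := Metric.tendsto_atTop.1 (tendsto_integral_expSumLaw hf.continuous hB) (ε / 2)
    (half_pos hε)
  obtain ⟨N₀, hN₀⟩ := hL
  filter_upwards [eventually_ge_atTop N₀, eventually_ge_atTop 16,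
    eventually_ge_atTop ⌈2 / ξ⌉₊] with N h1 h2 h3
  intro M hMN
  have hN16 : (16 : ℝ) ≤ N := by exact_mod_cast h2
  have hN0 : (0 : ℝ) < N := by linarith
  have hξN : 2 ≤ ξ * N := by
    have := (Nat.ceil_le.1 h3)
    rw [div_le_iff₀ hξ] at this
    linarith
  have hM1 : (M : ℝ) ≤ ξ * N := hMN ▸ Nat.floor_le (by positivity)
  have hM2 : ξ * N < M + 1 := hMN ▸ Nat.lt_floor_add_one _
  have hM0 : 1 ≤ M := by
    have : (0 : ℝ) < M := by linarith
    exact_mod_cast this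
  have hMhalf : ξ * N / 2 ≤ M := by linarith
  have hN1 : 1 ≤ N := by omega
  have hLN : N ≤ M + N - 1 := by omega
  have hLN' : (N : ℝ) ≤ (M + N - 1 : ℕ) := by exact_mod_cast hLN
  have hLle : ((M + N - 1 : ℕ) : ℝ) ≤ (1 + ξ) * N := by
    have : ((M + N - 1 : ℕ) : ℝ) ≤ (M + N : ℕ) := by exact_mod_cast Nat.sub_le _ _
    push_cast at this
    linarith
  have hsum := sum_sq_visitProb_le hN1 hM0
  set L : ℝ := ((M + N - 1 : ℕ) : ℝ) with hLdef
  have hL0 : 0 < L := hN0.trans_le hLN'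
  set c : ↥(box N M) → ℝ := fun a => (√L)⁻¹ * visitProb N M a with hc
  have hc0 : ∀ a, 0 ≤ c a := fun a => mul_nonneg (by positivity) (visitProb_nonneg _ _ _)
  have hq0 : 0 < √√(N : ℝ) := by positivity
  have hq2 : 2 ≤ √√(N : ℝ) := by
    rw [Real.le_sqrt' (by norm_num), Real.le_sqrt' (by norm_num)]
    linarith
  have hqs : √√(N : ℝ) ^ 2 = √N := Real.sq_sqrt (by positivity)
  have hlc : ∀ a, √√(N : ℝ) * c a ≤ 1 / 2 := by
    intro a
    calc √√(N : ℝ) * c a ≤ √√(N : ℝ) * ((√N)⁻¹ * 1) := by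
          simp only [hc]
          gcongr
          · exact visitProb_nonneg _ _ _
          · exact visitProb_le_one _ _ _
      _ = (√√(N : ℝ))⁻¹ := by
          rw [mul_one]
          nth_rewrite 2 [← hqs]
          field_simp
      _ ≤ 1 / 2 := by rw [one_div]; exact inv_anti₀ (by norm_num) hq2
  have hcs : √√(N : ℝ) ^ 2 * ∑ a, c a ^ 2 ≤ C := by
    have e : ∑ a, c a ^ 2 = L⁻¹ * ∑ s ∈ box N M, visitProb N M s ^ 2 := by
      simp only [hc]
      rw [← Finset.sum_coe_sort (box N M) fun s => visitProb N M s ^ 2, Finset.mul_sum]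
      refine Finset.sum_congr rfl fun a _ => ?_
      rw [mul_pow, inv_pow, Real.sq_sqrt hL0.le]
    have hS0 : 0 ≤ ∑ s ∈ box N M, visitProb N M s ^ 2 := Finset.sum_nonneg fun _ _ => sq_nonneg _
    rw [hqs, e, hC]
    generalize ∑ s ∈ box N M, visitProb N M s ^ 2 = S at hS0 hsum
    refine Real.le_sqrt_of_sq_le ?_
    rw [mul_pow, Real.sq_sqrt hN0.le, mul_pow, inv_pow]
    have hM0' : (0 : ℝ) < M := by exact_mod_cast hM0
    have h5 : S ^ 2 ≤ 8 * L ^ 3 / (N * M) := by rwa [le_div_iff₀ (by positivity)]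
    calc (N : ℝ) * ((L ^ 2)⁻¹ * S ^ 2) ≤ N * ((L ^ 2)⁻¹ * (8 * L ^ 3 / (N * M))) := by gcongr
      _ = 8 * L / M := by field_simp
      _ ≤ 8 * ((1 + ξ) * N) / (ξ * N / 2) := by gcongr
      _ = _ := by field_simp; ring
  have hconc := measure_pi_stdExp_abs_sub_ge_le (c := c) hc0
    (fun x => abs_pathAvgCentered_le x (fun _ => 1) hB0 hB)
    (fun x y => abs_pathAvgCentered_sub_le (fun _ => 1) x y hf) hq0 hlc (ε / 2)
  rw [integral_pathAvgCentered_stdExp hN1 hM0 hf.continuous hB] at hconc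
  have hclose := hN₀ (M + N - 1) (h1.trans hLN)
  rw [Real.dist_eq] at hclose
  refine (measureReal_mono fun x hx => ?_).trans (hconc.trans ?_)
  · simp only [Set.mem_ofPred_eq] at hx ⊢
    have := abs_sub_le (pathAvgCentered N M x (fun _ => 1) f)
      (∫ x, f x ∂expSumLaw (M + N - 1)) (∫ x, f x ∂gaussianReal 0 1)
    linarith
  · gcongr 2 * exp (_ + ?_)
    rw [mul_assoc]
    linarith

/-- The solid simplex `simplexLe` as a set of functions. -/
def simplexLeFun (ι : Type) [Fintype ι] : Set (ι → ℝ) :=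
  {x | (∀ i, 0 ≤ x i) ∧ ∑ i, x i ≤ (Fintype.card ι : ℝ)}

lemma measurableSet_simplexLeFun (ι : Type) [Fintype ι] : MeasurableSet (simplexLeFun ι) := by
  unfold simplexLeFun
  measurability

lemma stdExp_eq_withDensity_indicator :
    stdExp = volume.withDensity
      fun x => ENNReal.ofReal ((Set.Ici (0 : ℝ)).indicator (fun x => exp (-x)) x) := by
  rw [stdExp, ← Measure.restrict_congr_set Ioi_ae_eq_Ici.symm,
    ← withDensity_indicator measurableSet_Ici]
  congr 1
  ext x
  by_cases h : x ∈ Set.Ici (0 : ℝ) <;> simp [h]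

lemma integrable_indicator_exp_neg :
    Integrable ((Set.Ici (0 : ℝ)).indicator fun x => exp (-x)) := by
  rw [integrable_indicator_iff measurableSet_Ici, integrableOn_Ici_iff_integrableOn_Ioi]
  simpa using integrableOn_exp_mul_Ioi (a := -1) (by norm_num) 0

lemma pi_stdExp_eq_withDensity (ι : Type) [Fintype ι] :
    (Measure.pi fun _ : ι => stdExp) = volume.withDensity fun x => ENNReal.ofReal
      (∏ i, (Set.Ici (0 : ℝ)).indicator (fun x => exp (-x)) (x i)) := by
  have hpos : ∀ x : ℝ, 0 ≤ (Set.Ici (0 : ℝ)).indicator (fun x => exp (-x)) x :=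
    fun x => Set.indicator_nonneg (fun _ _ => (exp_pos _).le) x
  have hm : Measurable ((Set.Ici (0 : ℝ)).indicator fun x => exp (-x)) :=
    (by fun_prop : Measurable fun x : ℝ => exp (-x)).indicator measurableSet_Ici
  refine Measure.pi_eq fun s hs => ?_
  have h1 : ∀ i, stdExp (s i) = ENNReal.ofReal
      (∫ x, (s i).indicator ((Set.Ici (0 : ℝ)).indicator fun x => exp (-x)) x) := fun i => by
    rw [stdExp_eq_withDensity_indicator, withDensity_apply _ (hs i),
      integral_indicator (hs i),
      ofReal_integral_eq_lintegral_ofReal integrable_indicator_exp_neg.integrableOn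
        (.of_forall hpos)]
  simp_rw [h1]
  rw [withDensity_apply _ (.univ_pi hs), ← ENNReal.ofReal_prod_of_nonneg
    fun i _ => integral_nonneg fun x => Set.indicator_nonneg (fun _ _ => hpos _) x,
    ← integral_fintype_prod_eq_prod, ofReal_integral_eq_lintegral_ofReal,
    ← lintegral_indicator (.univ_pi hs)]
  · refine lintegral_congr fun x => ?_
    by_cases h : x ∈ Set.univ.pi s
    · have : ∀ i, x i ∈ s i := fun i => h i trivial
      simp [h, this]
    · rw [Set.indicator_of_notMem h]
      obtain ⟨i, hi⟩ : ∃ i, x i ∉ s i := by simpa [Set.mem_pi] using h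
      rw [Finset.prod_eq_zero (f := fun i => (s i).indicator
        ((Set.Ici (0 : ℝ)).indicator fun x => exp (-x)) (x i)) (Finset.mem_univ i)
        (Set.indicator_of_notMem hi _)]
      simp
  · exact Integrable.fintype_prod fun i => integrable_indicator_exp_neg.indicator (hs i)
  · exact .of_forall fun x => Finset.prod_nonneg fun i _ =>
      Set.indicator_nonneg (fun _ _ => hpos _) _

lemma stdExp_Ici {a : ℝ} (ha : 0 ≤ a) : stdExp (Set.Ici a) = ENNReal.ofReal (exp (-a)) := by
  have h1 : Set.Ici a ∩ Set.Ici 0 = Set.Ici a := by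
    rw [Set.inter_eq_left]
    exact Set.Ici_subset_Ici.2 ha
  have h2 : IntegrableOn (fun x => exp (-x)) (Set.Ici a) := by
    rw [integrableOn_Ici_iff_integrableOn_Ioi]
    simpa using integrableOn_exp_mul_Ioi (a := -1) (by norm_num) a
  rw [stdExp, ← Measure.restrict_congr_set Ioi_ae_eq_Ici.symm,
    withDensity_apply _ measurableSet_Ici, Measure.restrict_restrict measurableSet_Ici, h1,
    ← ofReal_integral_eq_lintegral_ofReal h2 (.of_forall fun x => (exp_pos _).le),
    integral_Ici_eq_integral_Ioi, integral_exp_neg_Ioi]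

lemma ae_stdExp_pos : ∀ᵐ t ∂stdExp, 0 < t := by
  refine (withDensity_absolutelyContinuous _ _).ae_le ?_
  exact ae_restrict_mem measurableSet_Ioi

lemma lintegral_comp_smul {ι : Type} [Fintype ι] (h : (ι → ℝ) → ENNReal) (hh : Measurable h) {r : ℝ}
    (hr : 0 < r) :
    ∫⁻ x, h x = ENNReal.ofReal (r ^ Fintype.card ι) * ∫⁻ y, h (r • y) := by
  have h1 := Measure.map_addHaar_smul (volume : Measure (ι → ℝ)) hr.ne'
  rw [← lintegral_map hh (measurable_const_smul r), h1, lintegral_smul_measure, smul_eq_mul,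
    ← mul_assoc, ← ENNReal.ofReal_mul (by positivity), Module.finrank_fintype_fun_eq_card,
    abs_of_pos (by positivity), mul_inv_cancel₀ (by positivity)]
  simp

/-- A vector of independent exponential variables is a mixture of uniform variables on the dilates of
the solid simplex. -/
lemma lintegral_pi_stdExp_eq {ι : Type} [Fintype ι] [Nonempty ι] {g : (ι → ℝ) → ENNReal}
    (hg : Measurable g) :
    ∫⁻ x, g x ∂(Measure.pi fun _ : ι => stdExp) =
      ∫⁻ t, ENNReal.ofReal ((t / Fintype.card ι) ^ Fintype.card ι) *
        (∫⁻ y in simplexLeFun ι, g ((t / Fintype.card ι) • y)) ∂stdExp := by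
  have hn : (0 : ℝ) < Fintype.card ι := by exact_mod_cast Fintype.card_pos
  let K : Set ((ι → ℝ) × ℝ) := {p | (∀ i, 0 ≤ p.1 i) ∧ ∑ i, p.1 i ≤ p.2}
  have hK : MeasurableSet K := by
    have h1 : MeasurableSet {p : (ι → ℝ) × ℝ | ∑ i, p.1 i ≤ p.2} :=
      measurableSet_le (by fun_prop) (by fun_prop)
    have h2 : MeasurableSet {p : (ι → ℝ) × ℝ | ∀ i, 0 ≤ p.1 i} := by
      rw [Set.ofPred_forall]
      exact MeasurableSet.iInter fun i => measurableSet_le (by fun_prop) (by fun_prop)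
    exact h2.inter h1
  have hm : Measurable fun x : ι → ℝ => ENNReal.ofReal
      (∏ i, (Set.Ici (0 : ℝ)).indicator (fun x => exp (-x)) (x i)) := by
    refine ENNReal.measurable_ofReal.comp (Finset.measurable_prod _ fun i _ => ?_)
    exact ((by fun_prop : Measurable fun x : ℝ => exp (-x)).indicator measurableSet_Ici).comp
      (measurable_pi_apply i)
  rw [pi_stdExp_eq_withDensity, lintegral_withDensity_eq_lintegral_mul _ hm hg]
  have h1 : ∀ x : ι → ℝ, ENNReal.ofReal
      (∏ i, (Set.Ici (0 : ℝ)).indicator (fun x => exp (-x)) (x i)) * g x =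
      ∫⁻ t, K.indicator (fun p => g p.1) (x, t) ∂stdExp := by
    intro x
    by_cases hx : ∀ i, 0 ≤ x i
    · have e : ∀ t, K.indicator (fun p => g p.1) (x, t) =
          (Set.Ici (∑ i, x i)).indicator (fun _ => g x) t := fun t => by
        simp only [Set.indicator_apply, K, Set.mem_ofPred_eq, Set.mem_Ici, hx, true_and, implies_true]
      simp_rw [e]
      rw [lintegral_indicator_const measurableSet_Ici,
        stdExp_Ici (Finset.sum_nonneg fun i _ => hx i), mul_comm, ← Finset.sum_neg_distrib, exp_sum]
      congr 3
      ext i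
      simp [hx i]
    · have e : ∀ t, K.indicator (fun p => g p.1) (x, t) = 0 := fun t =>
        Set.indicator_of_notMem (fun h => hx h.1) _
      simp_rw [e]
      push Not at hx
      obtain ⟨i, hi⟩ := hx
      rw [Finset.prod_eq_zero (f := fun i => (Set.Ici (0 : ℝ)).indicator (fun x => exp (-x)) (x i))
        (Finset.mem_univ i) (Set.indicator_of_notMem (by simpa using hi) _)]
      simp
  simp only [Pi.mul_apply, h1]
  rw [lintegral_lintegral_swap (f := fun x t => K.indicator (fun p => g p.1) (x, t)) ((hg.comp measurable_fst).indicator hK).aemeasurable]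
  refine lintegral_congr_ae ?_
  filter_upwards [ae_stdExp_pos] with t ht
  have hr : 0 < t / Fintype.card ι := by positivity
  rw [lintegral_comp_smul (fun x => K.indicator (fun p => g p.1) (x, t)) (((hg.comp measurable_fst).indicator hK).comp
    (measurable_id.prodMk measurable_const)) hr, ← lintegral_indicator (measurableSet_simplexLeFun ι)]
  congr 1
  refine lintegral_congr fun y => ?_
  simp only [Set.indicator_apply, K, simplexLeFun, Set.mem_ofPred_eq, Pi.smul_apply, smul_eq_mul]
  congr 1
  rw [← Finset.mul_sum, div_mul_eq_mul_div, div_le_iff₀ hn]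
  simp [hr, ht]

lemma integral_gamma_weight (n k : ℕ) :
    ∫ t, t ^ n / n.factorial * t ^ k ∂stdExp = ((n + k).factorial : ℝ) / n.factorial := by
  rw [← integral_pow_stdExp (n + k), ← integral_div]
  congr 1
  ext t
  ring

lemma integrable_gamma_weight (n k : ℕ) :
    Integrable (fun t : ℝ => t ^ n / n.factorial * t ^ k) stdExp := by
  convert (integrable_pow_stdExp (n + k)).div_const (n.factorial : ℝ) using 1
  ext t
  ring

lemma lintegral_gamma_weight_ge (n : ℕ) :
    2⁻¹ ≤ ∫⁻ t in {t : ℝ | |t - (n + 1)| ≤ 2 * √(n + 1)},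
      ENNReal.ofReal (t ^ n / n.factorial) ∂stdExp := by
  set S := {t : ℝ | |t - (n + 1)| ≤ 2 * √(n + 1)} with hS
  have hSm : MeasurableSet S := measurableSet_le (by fun_prop) (by fun_prop)
  have hn : (0 : ℝ) < n + 1 := by positivity
  have hint : Integrable (fun t : ℝ => t ^ n / n.factorial) stdExp := by
    simpa using integrable_gamma_weight n 0
  have hpos : ∀ᵐ t : ℝ ∂stdExp, 0 ≤ t ^ n / n.factorial := by
    filter_upwards [ae_stdExp_pos] with t ht
    positivity
  rw [← ofReal_integral_eq_lintegral_ofReal hint.integrableOn (ae_restrict_of_ae hpos),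
    ← integral_indicator hSm]
  have h1 : ∫ t, ((1 - (n + 1) / 4) * (t ^ n / n.factorial * t ^ 0)
      + 2⁻¹ * (t ^ n / n.factorial * t ^ 1)
      - (4 * (n + 1) : ℝ)⁻¹ * (t ^ n / n.factorial * t ^ 2)) ∂stdExp = 3 / 4 := by
    rw [integral_sub, integral_add, integral_const_mul, integral_const_mul, integral_const_mul,
      integral_gamma_weight, integral_gamma_weight, integral_gamma_weight]
    · have := Nat.factorial_ne_zero n
      rw [add_zero, Nat.factorial_succ (n + 1), Nat.factorial_succ n]
      push_cast
      field_simp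
      ring
    · exact (integrable_gamma_weight n 0).const_mul _
    · exact (integrable_gamma_weight n 1).const_mul _
    · exact ((integrable_gamma_weight n 0).const_mul _).add ((integrable_gamma_weight n 1).const_mul _)
    · exact (integrable_gamma_weight n 2).const_mul _
  have h2 : (3 : ℝ) / 4 ≤ ∫ t, S.indicator (fun t => t ^ n / n.factorial) t ∂stdExp := by
    rw [← h1]
    refine integral_mono_ae ?_ (hint.indicator hSm) ?_
    · exact (((integrable_gamma_weight n 0).const_mul _).add
        ((integrable_gamma_weight n 1).const_mul _)).sub ((integrable_gamma_weight n 2).const_mul _)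
    filter_upwards [hpos] with t ht
    have h3 : (1 - (n + 1) / 4) * (t ^ n / n.factorial * t ^ 0)
      + 2⁻¹ * (t ^ n / n.factorial * t ^ 1)
      - (4 * (n + 1) : ℝ)⁻¹ * (t ^ n / n.factorial * t ^ 2) =
      t ^ n / n.factorial * (1 - (t - (n + 1)) ^ 2 / (4 * (n + 1))) := by
      field_simp
      ring
    rw [h3]
    by_cases h : t ∈ S
    · rw [Set.indicator_of_mem h]
      refine mul_le_of_le_one_right ht ?_
      have : 0 ≤ (t - (n + 1)) ^ 2 / (4 * (n + 1)) := by positivity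
      linarith
    · rw [Set.indicator_of_notMem h]
      refine mul_nonpos_of_nonneg_of_nonpos ht ?_
      rw [sub_nonpos, one_le_div (by positivity)]
      have h4 : 2 * √(n + 1) < |t - (n + 1)| := not_le.1 h
      have h5 := Real.sq_sqrt hn.le
      rw [← sq_abs (t - _)]
      nlinarith [Real.sqrt_nonneg ((n : ℝ) + 1)]
  rw [ENNReal.le_ofReal_iff_toReal_le (by simp) (by linarith)]
  refine le_trans ?_ h2
  norm_num

/-- The uniform probability measure on the solid simplex of functions. -/
noncomputable def simplexLeFunUniform (ι : Type) [Fintype ι] : Measure (ι → ℝ) :=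
  (volume (simplexLeFun ι))⁻¹ • volume.restrict (simplexLeFun ι)

lemma volume_simplexLeFun (ι : Type) [Fintype ι] [Nonempty ι] :
    volume (simplexLeFun ι) = ENNReal.ofReal
      ((Fintype.card ι : ℝ) ^ Fintype.card ι / (Fintype.card ι).factorial) := by
  have hn : (0 : ℝ) < Fintype.card ι := by exact_mod_cast Fintype.card_pos
  set n := Fintype.card ι with hn'
  have h := lintegral_pi_stdExp_eq (ι := ι) (g := fun _ => 1) measurable_const
  simp only [lintegral_const, measure_univ, mul_one, one_mul, Measure.restrict_apply_univ] at h
  rw [lintegral_mul_const _ (by fun_prop), ← ofReal_integral_eq_lintegral_ofReal] at h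
  · simp_rw [← hn', div_pow] at h
    rw [integral_div, integral_pow_stdExp] at h
    have h1 : (0 : ℝ) < n.factorial / n ^ n := by positivity
    rw [ENNReal.eq_inv_of_mul_eq_one_left ((mul_comm _ _).trans h.symm),
      ← ENNReal.ofReal_inv_of_pos h1, inv_div]
  · simp_rw [← hn', div_pow]
    exact (integrable_pow_stdExp _).div_const _
  · filter_upwards [ae_stdExp_pos] with t ht
    positivity

instance (ι : Type) [Fintype ι] [Nonempty ι] : IsProbabilityMeasure (simplexLeFunUniform ι) := by
  have hn : (0 : ℝ) < Fintype.card ι := by exact_mod_cast Fintype.card_pos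
  constructor
  rw [simplexLeFunUniform, Measure.smul_apply, Measure.restrict_apply_univ, smul_eq_mul,
    ENNReal.inv_mul_cancel]
  · rw [volume_simplexLeFun, ne_eq, ENNReal.ofReal_eq_zero, not_le]
    positivity
  · rw [volume_simplexLeFun]
    exact ENNReal.ofReal_ne_top

lemma ae_simplexLeFunUniform_mem (ι : Type) [Fintype ι] :
    ∀ᵐ y ∂simplexLeFunUniform ι, y ∈ simplexLeFun ι :=
  Measure.ae_smul_measure (ae_restrict_mem (measurableSet_simplexLeFun ι)) _

lemma lintegral_pi_stdExp_eq_simplexLeFunUniform {ι : Type} [Fintype ι] [Nonempty ι]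
    {g : (ι → ℝ) → ENNReal} (hg : Measurable g) :
    ∫⁻ x, g x ∂(Measure.pi fun _ : ι => stdExp) =
      ∫⁻ t, ENNReal.ofReal (t ^ Fintype.card ι / (Fintype.card ι).factorial) *
        (∫⁻ y, g ((t / Fintype.card ι) • y) ∂simplexLeFunUniform ι) ∂stdExp := by
  have hn : (0 : ℝ) < Fintype.card ι := by exact_mod_cast Fintype.card_pos
  rw [lintegral_pi_stdExp_eq hg]
  refine lintegral_congr_ae ?_
  filter_upwards [ae_stdExp_pos] with t ht
  rw [simplexLeFunUniform, lintegral_smul_measure, volume_simplexLeFun, smul_eq_mul, ← mul_assoc,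
    ← ENNReal.ofReal_inv_of_pos (by positivity), ← ENNReal.ofReal_mul (by positivity)]
  congr 2
  rw [div_pow]
  field_simp

lemma integral_apply_simplexLeFunUniform {ι : Type} [Fintype ι] (a : ι) :
    ∫ y, y a ∂simplexLeFunUniform ι = Fintype.card ι / (Fintype.card ι + 1) := by
  have : Nonempty ι := ⟨a⟩
  have hn : (0 : ℝ) < Fintype.card ι := by exact_mod_cast Fintype.card_pos
  have h := lintegral_pi_stdExp_eq_simplexLeFunUniform (ι := ι) (g := fun x => ENNReal.ofReal (x a))
    (by fun_prop)
  have h1 : ∫⁻ x, ENNReal.ofReal (x a) ∂(Measure.pi fun _ : ι => stdExp) = 1 := by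
    rw [(measurePreserving_eval (fun _ : ι => stdExp) a).lintegral_comp
      (f := fun x => ENNReal.ofReal x) (by fun_prop), ← ofReal_integral_eq_lintegral_ofReal,
      integral_id_stdExp, ENNReal.ofReal_one]
    · simpa using integrable_pow_stdExp 1
    · exact ae_stdExp_pos.mono fun _ h => h.le
  have h2 : ∀ᵐ t ∂stdExp, ENNReal.ofReal (t ^ Fintype.card ι / (Fintype.card ι).factorial) *
      (∫⁻ y, ENNReal.ofReal (((t / Fintype.card ι) • y) a) ∂simplexLeFunUniform ι) =
      ENNReal.ofReal ((t ^ Fintype.card ι / (Fintype.card ι).factorial * t ^ 1) / Fintype.card ι) *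
        ∫⁻ y, ENNReal.ofReal (y a) ∂simplexLeFunUniform ι := by
    filter_upwards [ae_stdExp_pos] with t ht
    have h3 : ∀ y : ι → ℝ, ENNReal.ofReal (((t / Fintype.card ι) • y) a) =
        ENNReal.ofReal (t / Fintype.card ι) * ENNReal.ofReal (y a) := fun y => by
      rw [← ENNReal.ofReal_mul (by positivity)]
      rfl
    simp_rw [h3]
    rw [lintegral_const_mul _ (by fun_prop), ← mul_assoc, ← ENNReal.ofReal_mul (by positivity)]
    congr 2
    ring
  rw [h1, lintegral_congr_ae h2, lintegral_mul_const _ (by fun_prop),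
    ← ofReal_integral_eq_lintegral_ofReal, integral_div, integral_gamma_weight] at h
  · rw [integral_eq_lintegral_of_nonneg_ae]
    · have h3 : ((Fintype.card ι + 1).factorial : ℝ) / (Fintype.card ι).factorial / Fintype.card ι =
          (Fintype.card ι + 1) / Fintype.card ι := by
        have := Nat.factorial_ne_zero (Fintype.card ι)
        rw [Nat.factorial_succ]
        push_cast
        field_simp
      rw [h3] at h
      rw [ENNReal.eq_inv_of_mul_eq_one_left ((mul_comm _ _).trans h.symm),
        ← ENNReal.ofReal_inv_of_pos (by positivity), inv_div, ENNReal.toReal_ofReal (by positivity)]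
    · exact (ae_simplexLeFunUniform_mem ι).mono fun y hy => hy.1 a
    · exact (measurable_pi_apply a).aestronglyMeasurable
  · exact (integrable_gamma_weight _ 1).div_const _
  · filter_upwards [ae_stdExp_pos] with t ht
    positivity

/-- Events for the uniform measure on the simplex are controlled by events for independent exponential
variables. -/
lemma simplexLeFunUniform_le {ι : Type} [Fintype ι] [Nonempty ι] {A A' : Set (ι → ℝ)}
    (hA' : MeasurableSet A')
    (h : ∀ y ∈ A, y ∈ simplexLeFun ι → ∀ t : ℝ, 0 < t →
      |t - (Fintype.card ι + 1)| ≤ 2 * √(Fintype.card ι + 1) → (t / Fintype.card ι) • y ∈ A') :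
    simplexLeFunUniform ι A ≤ 2 * (Measure.pi fun _ : ι => stdExp) A' := by
  set n := Fintype.card ι with hn
  set S := {t : ℝ | |t - (n + 1)| ≤ 2 * √(n + 1)} with hS
  have hSm : MeasurableSet S := measurableSet_le (by fun_prop) (by fun_prop)
  have h1 : 2⁻¹ * simplexLeFunUniform ι A ≤ (Measure.pi fun _ : ι => stdExp) A' := by
    rw [← lintegral_indicator_one hA', lintegral_pi_stdExp_eq_simplexLeFunUniform
      (measurable_one.indicator hA')]
    refine (mul_le_mul_left (lintegral_gamma_weight_ge n) _).trans ?_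
    rw [← lintegral_mul_const _ (by fun_prop), ← lintegral_indicator hSm]
    refine lintegral_mono_ae ?_
    filter_upwards [ae_stdExp_pos] with t ht
    by_cases htS : t ∈ S
    · rw [Set.indicator_of_mem htS]
      refine mul_le_mul_right ?_ _
      have h2 : Measurable fun y : ι → ℝ => (t / n) • y := measurable_const_smul _
      rw [show (∫⁻ y, A'.indicator 1 ((t / n) • y) ∂simplexLeFunUniform ι) =
        simplexLeFunUniform ι ((fun y : ι → ℝ => (t / n) • y) ⁻¹' A') from by
          rw [← lintegral_indicator_one (h2 hA')]; rfl]
      refine measure_mono_ae ?_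
      filter_upwards [ae_simplexLeFunUniform_mem ι] with y hy hyA
      exact h y hyA hy t ht htS
    · rw [Set.indicator_of_notMem htS]
      exact zero_le
  calc simplexLeFunUniform ι A = 2 * (2⁻¹ * simplexLeFunUniform ι A) := by
        rw [← mul_assoc, ENNReal.mul_inv_cancel (by simp) (by simp), one_mul]
    _ ≤ _ := by gcongr

lemma continuous_pathAvgCentered {N M : ℕ} (V : ↥(box N M) → ℝ) {f : ℝ → ℝ}
    (hf : LipschitzWith 1 f) : Continuous fun x => pathAvgCentered N M x V f :=
  continuous_of_abs_sub_le_sum fun x y => abs_pathAvgCentered_sub_le V x y hf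

/-- Rescaling all the weights by a factor close to `1` changes the quenched average by little. -/
lemma abs_pathAvgCentered_smul_sub_le {N M : ℕ} (hN : 1 ≤ N) (hM : 1 ≤ M) (e : ↥(box N M) → ℝ)
    {r q K δ B : ℝ} {f : ℝ → ℝ} (hf : LipschitzWith 1 f) (hB : ∀ x, |f x| ≤ B) (hK : |r - 1| ≤ K⁻¹)
    (hδ : √((M + N - 1 : ℕ) : ℝ) * |r - q| ≤ δ) :
    |pathAvgCentered N M (r • e) (fun _ => q) f - pathAvgCentered N M e (fun _ => 1) f| ≤
      pathAvgCentered N M e (fun _ => 1) (fun x => min (2 * B) (K⁻¹ * |x|)) + δ := by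
  have hδ0 : 0 ≤ δ := le_trans (by positivity) hδ
  set L := M + N - 1 with hL
  have hL0 : (0 : ℝ) < L := by
    have : 0 < L := by omega
    exact_mod_cast this
  have h1 : ∀ s ∈ upRightPaths N M,
      |f ((√(L : ℝ))⁻¹ * ∑ a : ↥(box N M), if (a : ℕ × ℕ) ∈ s then (r • e) a - q else 0) -
        f ((√(L : ℝ))⁻¹ * ∑ a : ↥(box N M), if (a : ℕ × ℕ) ∈ s then e a - 1 else 0)| ≤
      min (2 * B) (K⁻¹ *
        |(√(L : ℝ))⁻¹ * ∑ a : ↥(box N M), if (a : ℕ × ℕ) ∈ s then e a - 1 else 0|) + δ := by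
    intro s hs
    have h2 : (∑ a : ↥(box N M), if (a : ℕ × ℕ) ∈ s then (r • e) a - q else 0) =
        r * (∑ a : ↥(box N M), if (a : ℕ × ℕ) ∈ s then e a - 1 else 0) + L * (r - q) := by
      rw [hL, ← card_filter_mem_upRightPath hN hM hs, Finset.mul_sum, ← nsmul_eq_mul,
        ← Finset.sum_const, Finset.sum_filter, ← Finset.sum_add_distrib]
      refine Finset.sum_congr rfl fun a _ => ?_
      split_ifs
      · simp only [Pi.smul_apply, smul_eq_mul]
        ring
      · simp
    rw [h2]
    set S := ∑ a : ↥(box N M), if (a : ℕ × ℕ) ∈ s then e a - 1 else 0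
    set X := (√(L : ℝ))⁻¹ * S with hX
    have h3 : (√(L : ℝ))⁻¹ * (r * S + L * (r - q)) = r * X + √L * (r - q) := by
      have h4 : (√(L : ℝ))⁻¹ * L = √L := by
        rw [inv_mul_eq_div, div_sqrt]
      rw [mul_add, ← mul_assoc (√(L : ℝ))⁻¹ (L : ℝ), h4, hX]
      ring
    rw [h3]
    rw [← sub_le_iff_le_add, le_min_iff]
    constructor
    · have := abs_sub (f (r * X + √L * (r - q))) (f X)
      linarith [hB (r * X + √L * (r - q)), hB X]
    · have h5 := hf.dist_le_mul (r * X + √L * (r - q)) X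
      rw [NNReal.coe_one, one_mul, Real.dist_eq, Real.dist_eq,
        show r * X + √L * (r - q) - X = (r - 1) * X + √L * (r - q) by ring] at h5
      have h6 := abs_add_le ((r - 1) * X) (√L * (r - q))
      rw [abs_mul, abs_mul √(L : ℝ), abs_of_nonneg (sqrt_nonneg _)] at h6
      have := mul_le_mul_of_nonneg_right hK (abs_nonneg X)
      linarith
  simp only [pathAvgCentered]
  rw [← mul_sub, ← Finset.sum_sub_distrib, abs_mul, abs_of_nonneg (by positivity)]
  calc _ ≤ ((upRightPaths N M).card : ℝ)⁻¹ * ∑ s ∈ upRightPaths N M, (min (2 * B) (K⁻¹ *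
        |(√(L : ℝ))⁻¹ * ∑ a : ↥(box N M), if (a : ℕ × ℕ) ∈ s then e a - 1 else 0|) + δ) :=
        mul_le_mul_of_nonneg_left
          ((Finset.abs_sum_le_sum_abs _ _).trans (Finset.sum_le_sum h1)) (by positivity)
    _ = _ := by
        have hc : (0 : ℝ) < (upRightPaths N M).card := by
          exact_mod_cast upRightPaths_card_pos hN hM
        rw [Finset.sum_add_distrib, mul_add, Finset.sum_const, nsmul_eq_mul,
          inv_mul_cancel_left₀ hc.ne']

lemma eventually_mul_le_mul_floor {ξ : ℝ} (hξ : 0 < ξ) (C : ℝ) :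
    ∀ᶠ N : ℕ in atTop, ∀ M : ℕ, M = ⌊ξ * (N : ℝ)⌋₊ →
      1 ≤ N ∧ 1 ≤ M ∧ C * ((M + N - 1 : ℕ) : ℝ) ≤ N * M := by
  filter_upwards [eventually_ge_atTop 1, eventually_ge_atTop ⌈(|C| * (1 + ξ) + 1) / ξ⌉₊,
    eventually_ge_atTop ⌈1 / ξ⌉₊] with N h1 h2 h3 M hM
  have hN : (1 : ℝ) ≤ N := by exact_mod_cast h1
  have h2 := Nat.ceil_le.1 h2
  have h3 := Nat.ceil_le.1 h3
  rw [div_le_iff₀ hξ] at h2 h3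
  have hM1 : (M : ℝ) ≤ ξ * N := hM ▸ Nat.floor_le (by positivity)
  have hM2 : ξ * N < M + 1 := hM ▸ Nat.lt_floor_add_one _
  refine ⟨h1, hM ▸ Nat.le_floor (by push_cast; linarith), ?_⟩
  have hL : ((M + N - 1 : ℕ) : ℝ) ≤ (1 + ξ) * N := by
    have : ((M + N - 1 : ℕ) : ℝ) ≤ ((M + N : ℕ) : ℝ) := by exact_mod_cast Nat.sub_le _ _
    push_cast at this
    linarith
  calc C * ((M + N - 1 : ℕ) : ℝ) ≤ |C| * ((1 + ξ) * N) :=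
        mul_le_mul (le_abs_self C) hL (by positivity) (abs_nonneg C)
    _ = N * (|C| * (1 + ξ)) := by ring
    _ ≤ N * M := by gcongr; linarith

lemma abs_div_sub_le {n L t δ : ℝ} (hn : 15 ≤ n) (hL : 1 ≤ L) (hδ : 0 < δ)
    (h : 25 / δ ^ 2 * L ≤ n) (ht : |t - (n + 1)| ≤ 2 * √(n + 1)) :
    |n / t - 1| ≤ δ ∧ √L * |n / t - n / (n + 1)| ≤ δ := by
  have hs := Real.sq_sqrt (show 0 ≤ n + 1 by linarith)
  set s := √(n + 1) with hs'
  have hs4 : 4 ≤ s := Real.le_sqrt_of_sq_le (by linarith)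
  have ht2 : s ^ 2 / 2 ≤ t := by
    have := (abs_le.1 ht).1
    nlinarith
  have ht0 : 0 < t := by nlinarith
  have hn1 : n + 1 = s ^ 2 := hs.symm
  have h1 : |n / t - n / (n + 1)| ≤ 4 / s := by
    have e : n / t - n / (n + 1) = -((n / (n + 1)) * ((t - (n + 1)) / t)) := by
      have : n + 1 ≠ 0 := by linarith
      field_simp
      ring
    rw [e, abs_neg, abs_mul, abs_of_nonneg (div_nonneg (by linarith) (by linarith)), abs_div,
      abs_of_pos ht0]
    calc n / (n + 1) * (|t - (n + 1)| / t) ≤ 1 * (2 * s / (s ^ 2 / 2)) := by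
          gcongr
          rw [div_le_one (by linarith)]
          linarith
      _ = 4 / s := by field_simp; norm_num
  have h2 : √L * 5 ≤ δ * s := by
    refine abs_le_of_sq_le_sq' ?_ (by positivity) |>.2
    rw [mul_pow, mul_pow, Real.sq_sqrt (by linarith), ← hn1]
    rw [div_mul_eq_mul_div, div_le_iff₀ (by positivity)] at h
    nlinarith [sq_nonneg δ]
  have hL1 : 1 ≤ √L := Real.one_le_sqrt.2 hL
  have h3 : 5 / s ≤ δ := by
    rw [div_le_iff₀ (by linarith)]
    linarith
  constructor
  · have h4 : |n / (n + 1) - 1| ≤ 1 / s := by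
      rw [show n / (n + 1) - 1 = -(1 / (n + 1)) by
        have : n + 1 ≠ 0 := by linarith
        field_simp
        ring, abs_neg, abs_of_nonneg (div_nonneg zero_le_one (by linarith))]
      gcongr
      nlinarith
    calc |n / t - 1| ≤ |n / t - n / (n + 1)| + |n / (n + 1) - 1| := abs_sub_le _ _ _
      _ ≤ 4 / s + 1 / s := add_le_add h1 h4
      _ = 5 / s := by ring
      _ ≤ δ := h3
  · calc √L * |n / t - n / (n + 1)| ≤ √L * (4 / s) := by gcongr
      _ ≤ √L * 5 / s := by rw [mul_div_assoc]; gcongr; norm_num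
      _ ≤ δ := by rw [div_le_iff₀ (by linarith)]; exact h2

lemma lipschitzWith_min_inv_mul_abs {K : ℝ} (hK : 1 ≤ K) (c : ℝ) :
    LipschitzWith 1 fun x : ℝ => min c (K⁻¹ * |x|) := by
  refine LipschitzWith.const_min (LipschitzWith.of_dist_le_mul fun x y => ?_) c
  rw [NNReal.coe_one, one_mul, Real.dist_eq, Real.dist_eq, ← mul_sub, abs_mul,
    abs_of_nonneg (by positivity)]
  exact (mul_le_of_le_one_left (abs_nonneg _) (inv_le_one_of_one_le₀ hK)).trans
    (abs_abs_sub_abs_le x y)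

/-- The quenched law for weights uniform on the solid simplex concentrates around the standard
Gaussian law at a summable rate. -/
lemma exists_summable_simplexLeFunUniform_le {ξ : ℝ} (hξ : 0 < ξ) {f : ℝ → ℝ} {B : ℝ}
    (hf : LipschitzWith 1 f) (hB : ∀ x, |f x| ≤ B) {ε : ℝ} (hε : 0 < ε) :
    ∃ u : ℕ → ℝ, Summable u ∧ ∀ᶠ N : ℕ in atTop, ∀ M : ℕ, M = ⌊ξ * (N : ℝ)⌋₊ →
      simplexLeFunUniform ↥(box N M) {y | ε ≤ |pathAvgCentered N M y
        (fun _ => (Fintype.card ↥(box N M) : ℝ) / (Fintype.card ↥(box N M) + 1)) f -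
          ∫ x, f x ∂gaussianReal 0 1|} ≤ ENNReal.ofReal (u N) := by
  have hB0 : 0 ≤ B := (abs_nonneg _).trans (hB 0)
  set I := ∫ x, |x| ∂gaussianReal 0 1 with hI
  have hI0 : 0 ≤ I := integral_nonneg fun x => abs_nonneg x
  have hIint : Integrable (fun x : ℝ => |x|) (gaussianReal 0 1) :=
    ((memLp_id_gaussianReal 1).integrable le_rfl).abs
  set K := 1 + 8 * I / ε with hKdef
  have hK : 1 ≤ K := by rw [hKdef, le_add_iff_nonneg_right]; positivity
  set g : ℝ → ℝ := fun x => min (2 * B) (K⁻¹ * |x|) with hg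
  have hg0 : ∀ x, 0 ≤ g x := fun x => le_min (by positivity) (by positivity)
  have hgB : ∀ x, |g x| ≤ 2 * B := fun x => by rw [abs_of_nonneg (hg0 x)]; exact min_le_left _ _
  have hgL : LipschitzWith 1 g := lipschitzWith_min_inv_mul_abs hK _
  have hγg : ∫ x, g x ∂gaussianReal 0 1 ≤ ε / 8 := by
    calc ∫ x, g x ∂gaussianReal 0 1 ≤ ∫ x, K⁻¹ * |x| ∂gaussianReal 0 1 :=
          integral_mono_of_nonneg (.of_forall hg0) (hIint.const_mul _)
            (.of_forall fun x => min_le_right _ _)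
      _ = K⁻¹ * I := integral_const_mul _ _
      _ ≤ ε / 8 := by
          rw [inv_mul_le_iff₀ (by linarith), hKdef]
          have : 8 * I / ε * (ε / 8) = I := by field_simp
          linarith
  obtain ⟨u, hu, hu'⟩ := exists_summable_measure_pathAvgCentered_le hξ hf hB (half_pos hε)
  obtain ⟨v, hv, hv'⟩ := exists_summable_measure_pathAvgCentered_le hξ hgL hgB
    (show 0 < ε / 8 by positivity)
  set δ := min (ε / 8) K⁻¹ with hδdef
  have hδ : 0 < δ := lt_min (by positivity) (by positivity)
  refine ⟨fun N => 2 * (u N + v N), (hu.add hv).mul_left 2, ?_⟩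
  filter_upwards [hu', hv', eventually_mul_le_mul_floor hξ (25 / δ ^ 2),
    eventually_mul_le_mul_floor hξ 15] with N h1 h2 h3 h4 M hM
  obtain ⟨hN1, hM1, h3⟩ := h3 M hM
  have h4 := (h4 M hM).2.2
  have hL : (1 : ℝ) ≤ ((M + N - 1 : ℕ) : ℝ) := by
    have : 1 ≤ M + N - 1 := by omega
    exact_mod_cast this
  have hcard : (Fintype.card ↥(box N M) : ℝ) = N * M := by
    rw [Fintype.card_coe, box, Finset.card_product]
    simp
  have : Nonempty ↥(box N M) := ⟨⟨(1, 1), by simp [box, hN1, hM1]⟩⟩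
  set A₁ := {x : ↥(box N M) → ℝ | ε / 2 ≤
    |pathAvgCentered N M x (fun _ => 1) f - ∫ x, f x ∂gaussianReal 0 1|} with hA₁
  set A₂ := {x : ↥(box N M) → ℝ | ε / 8 ≤
    |pathAvgCentered N M x (fun _ => 1) g - ∫ x, g x ∂gaussianReal 0 1|} with hA₂
  have hA₁m : MeasurableSet A₁ := measurableSet_le measurable_const
    ((continuous_pathAvgCentered _ hf).sub continuous_const).abs.measurable
  have hA₂m : MeasurableSet A₂ := measurableSet_le measurable_const
    ((continuous_pathAvgCentered _ hgL).sub continuous_const).abs.measurable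
  refine (simplexLeFunUniform_le (hA₁m.union hA₂m) ?_).trans ?_
  · intro y hy _ t ht0 ht
    by_contra hcon
    simp only [Set.mem_union, not_or, hA₁, hA₂, Set.mem_ofPred_eq, not_le] at hcon
    set n := (Fintype.card ↥(box N M) : ℝ) with hn
    have hn15 : 15 ≤ n := by rw [hcard]; linarith
    obtain ⟨hr1, hr2⟩ := abs_div_sub_le hn15 hL hδ (by rw [hcard]; exact h3) ht
    have h5 := abs_pathAvgCentered_smul_sub_le hN1 hM1 ((t / n) • y) hf hB
      (hr1.trans (min_le_right _ _)) (hr2.trans (min_le_left _ _))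
    have h6 : (n / t) • (t / n) • y = y := by
      rw [smul_smul, div_mul_div_cancel₀ ht0.ne', div_self (by linarith), one_smul]
    rw [h6] at h5
    have hy : ε ≤ _ := hy
    have h7 := abs_sub_le (pathAvgCentered N M y (fun _ => n / (n + 1)) f)
      (pathAvgCentered N M ((t / n) • y) (fun _ => 1) f) (∫ x, f x ∂gaussianReal 0 1)
    have h8 := (abs_lt.1 hcon.2).2
    linarith [hcon.1]
  · rw [ENNReal.ofReal_mul zero_le_two, ENNReal.ofReal_ofNat]
    refine mul_le_mul_right ((measure_union_le _ _).trans ?_) _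
    rw [ENNReal.ofReal_add (measureReal_nonneg.trans (h1 M hM)) (measureReal_nonneg.trans (h2 M hM))]
    refine add_le_add ?_ ?_
    · exact (ENNReal.le_ofReal_iff_toReal_le (measure_ne_top _ _)
        (measureReal_nonneg.trans (h1 M hM))).2 (h1 M hM)
    · exact (ENNReal.le_ofReal_iff_toReal_le (measure_ne_top _ _)
        (measureReal_nonneg.trans (h2 M hM))).2 (h2 M hM)

/-- The maximum of the tent functions `x ↦ (r - |x - q|)⁺` over the pairs `(q, r)` in `S`. -/
noncomputable def tentMax (S : Finset (ℚ × ℚ)) (x : ℝ) : ℝ :=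
  (S.sup fun p => Real.toNNReal (p.2 - |x - p.1|) : NNReal)

lemma tentMax_nonneg (S : Finset (ℚ × ℚ)) (x : ℝ) : 0 ≤ tentMax S x := NNReal.coe_nonneg _

lemma tentMax_le {S : Finset (ℚ × ℚ)} {x c : ℝ} (hc : 0 ≤ c)
    (h : ∀ p ∈ S, (p.2 : ℝ) - |x - p.1| ≤ c) : tentMax S x ≤ c := by
  lift c to NNReal using hc
  rw [tentMax, NNReal.coe_le_coe]
  exact Finset.sup_le fun p hp => Real.toNNReal_le_iff_le_coe.2 (h p hp)

lemma le_tentMax {S : Finset (ℚ × ℚ)} {p : ℚ × ℚ} (hp : p ∈ S) (x : ℝ) :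
    (p.2 : ℝ) - |x - p.1| ≤ tentMax S x := by
  rw [tentMax, ← Real.toNNReal_le_iff_le_coe]
  exact Finset.le_sup (f := fun p : ℚ × ℚ => Real.toNNReal (p.2 - |x - p.1|)) hp

lemma lipschitzWith_tentMax (S : Finset (ℚ × ℚ)) : LipschitzWith 1 (tentMax S) := by
  refine LipschitzWith.of_le_add fun x y => ?_
  refine tentMax_le (add_nonneg (tentMax_nonneg S y) dist_nonneg) fun p hp => ?_
  have h1 := le_tentMax hp y
  have h2 := abs_sub_le y x p.1
  rw [Real.dist_eq, abs_sub_comm x y]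
  linarith

lemma exists_abs_tentMax_le (S : Finset (ℚ × ℚ)) : ∃ B, ∀ x, |tentMax S x| ≤ B := by
  refine ⟨∑ p ∈ S, |(p.2 : ℝ)|, fun x => ?_⟩
  rw [abs_of_nonneg (tentMax_nonneg S x)]
  refine tentMax_le (Finset.sum_nonneg fun _ _ => abs_nonneg _) fun p hp => ?_
  have h1 := Finset.single_le_sum (f := fun p : ℚ × ℚ => |(p.2 : ℝ)|) (fun _ _ => abs_nonneg _) hp
  have h2 := le_abs_self (p.2 : ℝ)
  have h3 := abs_nonneg (x - p.1)
  linarith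

lemma exists_tendsto_tentMax {f : ℝ → ℝ} (hf : LipschitzWith 1 f) (h0 : ∀ x, 0 ≤ f x) :
    ∃ S : ℕ → Finset (ℚ × ℚ), (∀ m x, tentMax (S m) x ≤ f x) ∧
      ∀ x, Tendsto (fun m => tentMax (S m) x) atTop (nhds (f x)) := by
  obtain ⟨e, he⟩ := exists_surjective_nat (ℚ × ℚ)
  have hlip : ∀ x y, f x ≤ f y + |x - y| := fun x y => by
    simpa [Real.dist_eq] using hf.le_add_mul x y
  let S : ℕ → Finset (ℚ × ℚ) := fun m =>
    ((Finset.range m).image e).filter fun p => (p.2 : ℝ) ≤ f p.1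
  have hle : ∀ m x, tentMax (S m) x ≤ f x := fun m x => by
    refine tentMax_le (h0 x) fun p hp => ?_
    have h1 := hlip p.1 x
    rw [abs_sub_comm] at h1
    linarith [(Finset.mem_filter.1 hp).2]
  refine ⟨S, hle, fun x => ?_⟩
  rw [Metric.tendsto_atTop]
  intro ε hε
  obtain ⟨q, hq1, hq2⟩ := exists_rat_btwn (show x < x + ε / 4 by linarith)
  obtain ⟨r, hr1, hr2⟩ := exists_rat_btwn (show f q - ε / 4 < f q by linarith)
  obtain ⟨k, hk⟩ := he (q, r)
  refine ⟨k + 1, fun m hm => ?_⟩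
  have hmem : (q, r) ∈ S m := by
    rw [Finset.mem_filter, Finset.mem_image]
    exact ⟨⟨k, Finset.mem_range.2 (by omega), hk⟩, hr2.le⟩
  have h1 := le_tentMax hmem x
  have h2 := hlip x q
  have h3 : |x - q| < ε / 4 := by rw [abs_sub_comm, abs_lt]; constructor <;> linarith
  simp only at h1
  rw [Real.dist_eq, abs_sub_comm, abs_of_nonneg (sub_nonneg.2 (hle m x))]
  linarith

/-- To prove weak convergence of averages it suffices to test against the countably many functions
`tentMax S`. -/
lemma tendsto_of_forall_tendsto_tentMax {A : ℕ → (ℝ → ℝ) → ℝ} {ν : Measure ℝ}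
    [IsProbabilityMeasure ν]
    (hmono : ∀ N f g, (∀ x, f x ≤ g x) → A N f ≤ A N g)
    (hadd : ∀ᶠ N in atTop, ∀ f c, A N (fun x => f x + c) = A N f + c)
    (hneg : ∀ N f, A N (fun x => -f x) = -A N f)
    (h : ∀ S, Tendsto (fun N => A N (tentMax S)) atTop (nhds (∫ x, tentMax S x ∂ν)))
    {f : ℝ → ℝ} {B : ℝ} (hf : LipschitzWith 1 f) (hB : ∀ x, |f x| ≤ B) :
    Tendsto (fun N => A N f) atTop (nhds (∫ x, f x ∂ν)) := by
  have lower : ∀ g : ℝ → ℝ, LipschitzWith 1 g → (∀ x, 0 ≤ g x) → (∀ x, g x ≤ 2 * B) → ∀ ε > 0,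
      ∀ᶠ N in atTop, ∫ x, g x ∂ν - ε < A N g := by
    intro g hg hg0 hgB ε hε
    obtain ⟨S, hS, hlim⟩ := exists_tendsto_tentMax hg hg0
    have hint : Tendsto (fun m => ∫ x, tentMax (S m) x ∂ν) atTop (nhds (∫ x, g x ∂ν)) := by
      refine tendsto_integral_of_dominated_convergence (fun _ => 2 * B)
        (fun m => (lipschitzWith_tentMax _).continuous.aestronglyMeasurable) (integrable_const _)
        (fun m => .of_forall fun x => ?_) (.of_forall hlim)
      rw [Real.norm_eq_abs, abs_of_nonneg (tentMax_nonneg _ _)]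
      exact (hS m x).trans (hgB x)
    obtain ⟨m, hm⟩ := (hint.eventually_const_lt (show _ - ε < _ by linarith)).exists
    filter_upwards [(h (S m)).eventually_const_lt hm] with N hN
    exact hN.trans_le (hmono N _ _ (hS m))
  have hfi : Integrable f ν := .of_bound hf.continuous.aestronglyMeasurable B (.of_forall hB)
  have hf' : LipschitzWith 1 fun x => -f x := hf.neg
  rw [Metric.tendsto_nhds]
  intro ε hε
  filter_upwards [hadd,
    lower (fun x => f x + B) (by simpa using hf.add (LipschitzWith.const B))
      (fun x => by linarith [(abs_le.1 (hB x)).1]) (fun x => by linarith [(abs_le.1 (hB x)).2]) ε hε,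
    lower (fun x => -f x + B) (by simpa using hf'.add (LipschitzWith.const B))
      (fun x => by linarith [(abs_le.1 (hB x)).2]) (fun x => by linarith [(abs_le.1 (hB x)).1]) ε hε]
    with N hN h1 h2
  rw [hN, integral_add hfi (integrable_const _)] at h1
  rw [hN, hneg, integral_add hfi.fun_neg (integrable_const _), integral_neg] at h2
  simp only [integral_const, probReal_univ, one_smul] at h1 h2
  rw [Real.dist_eq, abs_lt]
  constructor <;> linarith

lemma map_ofLp_simplexLeUniform (ι : Type) [Fintype ι] :
    (simplexLeUniform ι).map (WithLp.ofLp : EuclideanSpace ℝ ι → ι → ℝ) =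
      simplexLeFunUniform ι := by
  have h := PiLp.volume_preserving_ofLp ι
  have hS : simplexLe ι = WithLp.ofLp ⁻¹' simplexLeFun ι := rfl
  rw [simplexLeUniform, simplexLeFunUniform, Measure.map_smul, hS,
    h.measure_preimage (measurableSet_simplexLeFun ι).nullMeasurableSet,
    (h.restrict_preimage (measurableSet_simplexLeFun ι)).map_eq]

lemma pathAvgCentered_mono {N M : ℕ} (x V : ↥(box N M) → ℝ) {f g : ℝ → ℝ} (h : ∀ x, f x ≤ g x) :
    pathAvgCentered N M x V f ≤ pathAvgCentered N M x V g :=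
  mul_le_mul_of_nonneg_left (Finset.sum_le_sum fun _ _ => h _) (by positivity)

lemma pathAvgCentered_neg {N M : ℕ} (x V : ↥(box N M) → ℝ) (f : ℝ → ℝ) :
    pathAvgCentered N M x V (fun x => -f x) = -pathAvgCentered N M x V f := by
  simp [pathAvgCentered]

lemma pathAvgCentered_add_const {N M : ℕ} (hN : 1 ≤ N) (hM : 1 ≤ M) (x V : ↥(box N M) → ℝ)
    (f : ℝ → ℝ) (c : ℝ) :
    pathAvgCentered N M x V (fun x => f x + c) = pathAvgCentered N M x V f + c := by
  have hc : (0 : ℝ) < (upRightPaths N M).card := by exact_mod_cast upRightPaths_card_pos hN hM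
  rw [pathAvgCentered, Finset.sum_add_distrib, mul_add, Finset.sum_const, nsmul_eq_mul,
    inv_mul_cancel_left₀ hc.ne', pathAvgCentered]

/-- Borel–Cantelli: the quenched average of a fixed bounded Lipschitz function converges almost
surely. -/
lemma ae_tendsto_pathAvgCentered {ξ : ℝ} (hξ : 0 < ξ) {M : ℕ → ℕ} (hM : ∀ N, M N = ⌊ξ * (N : ℝ)⌋₊)
    {Ω : Type} [MeasurableSpace Ω] {P : Measure Ω}
    {W : ∀ N : ℕ, Ω → EuclideanSpace ℝ ↥(box N (M N))} (hmeas : ∀ N, Measurable (W N))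
    (hlaw : ∀ N, Measure.map (W N) P = simplexLeUniform ↥(box N (M N)))
    {f : ℝ → ℝ} {B : ℝ} (hf : LipschitzWith 1 f) (hB : ∀ x, |f x| ≤ B) :
    ∀ᵐ ω ∂P, Tendsto
      (fun N => pathAvgCentered N (M N) (fun a => W N ω a) (fun a => ∫ ω', W N ω' a ∂P) f)
      atTop (nhds (∫ x, f x ∂(gaussianReal 0 1))) := by
  have hofLp : ∀ N, Measurable fun ω => (WithLp.ofLp (W N ω) : ↥(box N (M N)) → ℝ) := fun N =>
    (PiLp.volume_preserving_ofLp _).measurable.comp (hmeas N)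
  have hlaw' : ∀ N, Measure.map (fun ω => (WithLp.ofLp (W N ω) : ↥(box N (M N)) → ℝ)) P =
      simplexLeFunUniform ↥(box N (M N)) := fun N => by
    rw [← map_ofLp_simplexLeUniform, ← hlaw N,
      Measure.map_map (PiLp.volume_preserving_ofLp _).measurable (hmeas N)]
    rfl
  have hmean : ∀ N, (fun a => ∫ ω', W N ω' a ∂P) = fun _ : ↥(box N (M N)) =>
      (Fintype.card ↥(box N (M N)) : ℝ) / (Fintype.card ↥(box N (M N)) + 1) := fun N => by
    ext a
    rw [← integral_apply_simplexLeFunUniform a, ← hlaw' N, integral_map (hofLp N).aemeasurable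
      (measurable_pi_apply a).aestronglyMeasurable]
  simp_rw [hmean]
  have key : ∀ k : ℕ, ∀ᵐ ω ∂P, ∀ᶠ N in atTop, ¬ ((1 : ℝ) / (k + 1) ≤
      |pathAvgCentered N (M N) (fun a => W N ω a) (fun _ : ↥(box N (M N)) =>
      (Fintype.card ↥(box N (M N)) : ℝ) / (Fintype.card ↥(box N (M N)) + 1)) f -
        ∫ x, f x ∂gaussianReal 0 1|) := by
    intro k
    obtain ⟨u, hu, hu'⟩ := exists_summable_simplexLeFunUniform_le hξ hf hB
      (show (0 : ℝ) < 1 / (k + 1) by positivity)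
    obtain ⟨N₀, hN₀⟩ := eventually_atTop.1 hu'
    have h1 : ∑' N, P {ω | (1 : ℝ) / (k + 1) ≤
        |pathAvgCentered (N + N₀) (M (N + N₀)) (fun a => W (N + N₀) ω a)
        (fun _ : ↥(box (N + N₀) (M (N + N₀))) => (Fintype.card ↥(box (N + N₀) (M (N + N₀))) : ℝ) /
          (Fintype.card ↥(box (N + N₀) (M (N + N₀))) + 1)) f -
        ∫ x, f x ∂gaussianReal 0 1|} ≠ ⊤ := by
      refine ne_top_of_le_ne_top ((summable_nat_add_iff N₀).2 hu).tsum_ofReal_ne_top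
        (ENNReal.tsum_le_tsum fun N => ?_)
      refine le_trans ?_ (hN₀ (N + N₀) (by omega) (M (N + N₀)) (hM _))
      rw [← hlaw']
      exact Measure.le_map_apply (hofLp _).aemeasurable _
    filter_upwards [ae_eventually_notMem h1] with ω hω
    filter_upwards [(tendsto_sub_atTop_nat N₀).eventually hω, eventually_ge_atTop N₀] with N hN hN'
    rwa [Nat.sub_add_cancel hN'] at hN
  filter_upwards [ae_all_iff.2 key] with ω hω
  rw [Metric.tendsto_nhds]
  intro ε hε
  obtain ⟨k, hk⟩ := exists_nat_one_div_lt hε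
  filter_upwards [hω k] with N hN
  rw [Real.dist_eq]
  exact (not_le.1 hN).trans hk

/-- Quenched CLT along up-right paths with weights uniform on the solid simplex `Δ_{(MN,≤)}`. -/
theorem stmt12
    (ξ : ℝ) (hξ : 0 < ξ)
    (M : ℕ → ℕ) (hM : ∀ N, M N = ⌊ξ * (N : ℝ)⌋₊)
    (Ω : Type) [MeasurableSpace Ω] (P : Measure Ω) [IsProbabilityMeasure P]
    (W : ∀ N : ℕ, Ω → EuclideanSpace ℝ ↥(box N (M N)))
    (hmeas : ∀ N, Measurable (W N))
    (hlaw : ∀ N, Measure.map (W N) P = simplexLeUniform ↥(box N (M N))) :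
    ∀ᵐ ω ∂P, ∀ f : ℝ → ℝ, (∃ B, ∀ x, |f x| ≤ B) → LipschitzWith 1 f →
      Tendsto
        (fun N => pathAvgCentered N (M N) (fun a => W N ω a)
          (fun a => ∫ ω', W N ω' a ∂P) f)
        atTop (nhds (∫ x, f x ∂(gaussianReal 0 1))) := by
  have h : ∀ᵐ ω ∂P, ∀ S, Tendsto
      (fun N => pathAvgCentered N (M N) (fun a => W N ω a) (fun a => ∫ ω', W N ω' a ∂P) (tentMax S))
      atTop (nhds (∫ x, tentMax S x ∂(gaussianReal 0 1))) := by
    refine ae_all_iff.2 fun S => ?_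
    obtain ⟨B, hB⟩ := exists_abs_tentMax_le S
    exact ae_tendsto_pathAvgCentered hξ hM hmeas hlaw (lipschitzWith_tentMax S) hB
  filter_upwards [h] with ω hω f ⟨B, hB⟩ hf
  refine tendsto_of_forall_tendsto_tentMax
    (A := fun N f => pathAvgCentered N (M N) (fun a => W N ω a) (fun a => ∫ ω', W N ω' a ∂P) f)
    (fun N f g => pathAvgCentered_mono _ _) ?_ (fun N f => pathAvgCentered_neg _ _ _) hω hf hB
  filter_upwards [eventually_mul_le_mul_floor hξ 0] with N hN f c
  obtain ⟨h1, h2, -⟩ := hN (M N) (hM N)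
  exact pathAvgCentered_add_const h1 h2 _ _ _ _
end

section
/- Finitely many uniform picks from the sphere: Let w be uniformly distributed on the sphere √N·S^{N−1} of radius √N in ℝ^N, let m ∈ ℕ be fixed, and let σ be chosen uniformly at random from the m-element subsets of {1, …, N}, independently of w. Then P_w-almost surely, the quenched law of m^{−1/2} Σ_{j∈σ} w_j given w converges weakly to the standard Gaussian distribution N(0,1) as N → ∞. -/
open MeasureTheory ProbabilityTheory Real Filter

/-- The uniform (normalized Hausdorff) probability measure on the sphere of radius `r`
centered at the origin of the Euclidean space `ℝ^ι`. -/
noncomputable def sphereUniform (ι : Type) [Fintype ι] (r : ℝ) :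
    Measure (EuclideanSpace ℝ ι) :=
  (μH[((Fintype.card ι - 1 : ℕ) : ℝ)] (Metric.sphere (0 : EuclideanSpace ℝ ι) r))⁻¹ •
    (μH[((Fintype.card ι - 1 : ℕ) : ℝ)]).restrict (Metric.sphere (0 : EuclideanSpace ℝ ι) r)

/-- The quenched average `E_σ f(m^{-1/2} Σ_{j∈σ} W_j)` over a uniformly random `m`-element
subset `σ` of the `N` coordinates, the vector `W` being fixed. -/
noncomputable def pickAvg (N m : ℕ) (W : Fin N → ℝ) (f : ℝ → ℝ) : ℝ :=
  ((N.choose m : ℕ) : ℝ)⁻¹ *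
    ∑ σ ∈ Finset.powersetCard m (Finset.univ : Finset (Fin N)),
      f ((Real.sqrt (m : ℝ))⁻¹ * ∑ j ∈ σ, W j)

/-- Adjoining one more index to a `k`-subset produces every `(k + 1)`-subset `k + 1` times. -/
lemma sum_powersetCard_compl_mul_prod {ι : Type*} [Fintype ι] [DecidableEq ι] (z : ι → ℂ)
    (k : ℕ) :
    ∑ σ ∈ Finset.powersetCard k (Finset.univ : Finset ι), ∑ j ∈ σᶜ, z j * ∏ i ∈ σ, z i =
      (k + 1 : ℂ) * ∑ τ ∈ Finset.powersetCard (k + 1) (Finset.univ : Finset ι), ∏ i ∈ τ, z i := by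
  have h : ∀ τ ∈ Finset.powersetCard (k + 1) (Finset.univ : Finset ι),
      (k + 1 : ℂ) * ∏ i ∈ τ, z i = ∑ _j ∈ τ, ∏ i ∈ τ, z i := by
    intro τ hτ
    rw [Finset.mem_powersetCard] at hτ
    simp [hτ.2]
  rw [Finset.mul_sum, Finset.sum_congr rfl h, Finset.sum_sigma', Finset.sum_sigma']
  refine Finset.sum_bij' (fun p _ => ⟨insert p.2 p.1, p.2⟩) (fun p _ => ⟨p.1.erase p.2, p.2⟩)
    ?_ ?_ ?_ ?_ ?_
  · rintro ⟨σ, j⟩ hp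
    simp only [Finset.mem_sigma, Finset.mem_powersetCard, Finset.mem_compl] at hp ⊢
    refine ⟨⟨Finset.subset_univ _, ?_⟩, Finset.mem_insert_self _ _⟩
    rw [Finset.card_insert_of_notMem hp.2, hp.1.2]
  · rintro ⟨σ, j⟩ hp
    simp only [Finset.mem_sigma, Finset.mem_powersetCard, Finset.mem_compl] at hp ⊢
    refine ⟨⟨Finset.subset_univ _, ?_⟩, Finset.notMem_erase _ _⟩
    rw [Finset.card_erase_of_mem hp.2, hp.1.2]; rfl
  · rintro ⟨σ, j⟩ hp
    simp only [Finset.mem_sigma, Finset.mem_compl] at hp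
    simp [Finset.erase_insert hp.2]
  · rintro ⟨σ, j⟩ hp
    simp only [Finset.mem_sigma] at hp
    simp [Finset.insert_erase hp.2]
  · rintro ⟨σ, j⟩ hp
    simp only [Finset.mem_sigma, Finset.mem_compl] at hp
    simp [Finset.prod_insert hp.2]

lemma norm_succ_mul_esymm_sub_le {N : ℕ} (z : Fin N → ℂ) (hz : ∀ j, ‖z j‖ ≤ 1) (k : ℕ) :
    ‖(k + 1 : ℂ) * ∑ τ ∈ Finset.powersetCard (k + 1) (Finset.univ : Finset (Fin N)),
          ∏ i ∈ τ, z i -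
        (∑ j, z j) * ∑ σ ∈ Finset.powersetCard k (Finset.univ : Finset (Fin N)), ∏ i ∈ σ, z i‖ ≤
      k * (N : ℝ) ^ k := by
  rw [← sum_powersetCard_compl_mul_prod, Finset.mul_sum, ← Finset.sum_sub_distrib]
  have hprod : ∀ σ : Finset (Fin N), ‖∏ i ∈ σ, z i‖ ≤ 1 := fun σ => by
    rw [norm_prod]; exact Finset.prod_le_one (fun _ _ => norm_nonneg _) (fun i _ => hz i)
  have hterm : ∀ σ ∈ Finset.powersetCard k (Finset.univ : Finset (Fin N)),
      ‖∑ j ∈ σᶜ, z j * ∏ i ∈ σ, z i - (∑ j, z j) * ∏ i ∈ σ, z i‖ ≤ k := by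
    intro σ hσ
    rw [Finset.mem_powersetCard] at hσ
    rw [← Finset.sum_mul, ← Finset.sum_add_sum_compl σ z, ← sub_mul, sub_add_cancel_right,
      norm_mul, norm_neg]
    calc ‖∑ i ∈ σ, z i‖ * ‖∏ i ∈ σ, z i‖ ≤ (∑ i ∈ σ, (1 : ℝ)) * 1 := by
          gcongr
          · exact norm_sum_le_of_le _ (fun i _ => hz i)
          · exact hprod σ
      _ = k := by simp [hσ.2]
  refine (norm_sum_le_of_le _ hterm).trans ?_
  rw [Finset.sum_const, Finset.card_powersetCard, Finset.card_univ, Fintype.card_fin,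
    nsmul_eq_mul, mul_comm]
  gcongr
  exact_mod_cast Nat.choose_le_pow N k

lemma tendsto_esymm_div_pow (z : ∀ N : ℕ, Fin N → ℂ) (hz : ∀ N j, ‖z N j‖ ≤ 1) (c : ℂ)
    (h : Tendsto (fun N : ℕ => (N : ℂ)⁻¹ * ∑ j, z N j) atTop (nhds c)) (k : ℕ) :
    Tendsto (fun N : ℕ => ((N : ℂ) ^ k)⁻¹ *
      ∑ σ ∈ Finset.powersetCard k (Finset.univ : Finset (Fin N)), ∏ i ∈ σ, z N i)
      atTop (nhds (c ^ k / k.factorial)) := by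
  induction k with
  | zero => simp
  | succ k ih =>
    have hdiff : Tendsto (fun N : ℕ => ((N : ℂ) ^ (k + 1))⁻¹ *
        ((k + 1 : ℂ) * ∑ τ ∈ Finset.powersetCard (k + 1) (Finset.univ : Finset (Fin N)),
            ∏ i ∈ τ, z N i -
          (∑ j, z N j) *
            ∑ σ ∈ Finset.powersetCard k (Finset.univ : Finset (Fin N)), ∏ i ∈ σ, z N i))
        atTop (nhds 0) := by
      have hlim : Tendsto (fun N : ℕ => (k : ℝ) / N) atTop (nhds 0) :=
        tendsto_const_div_atTop_nhds_zero_nat _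
      refine squeeze_zero_norm' ?_ hlim
      filter_upwards [eventually_gt_atTop 0] with N hN
      have hN' : (0 : ℝ) < N := by exact_mod_cast hN
      rw [norm_mul, norm_inv, norm_pow, Complex.norm_natCast]
      calc ((N : ℝ) ^ (k + 1))⁻¹ * _ ≤ ((N : ℝ) ^ (k + 1))⁻¹ * (k * (N : ℝ) ^ k) := by
            gcongr
            exact norm_succ_mul_esymm_sub_le (z N) (hz N) k
        _ = k / N := by field_simp; ring
    have hsum := (hdiff.add (h.mul ih)).const_mul ((k + 1 : ℂ)⁻¹)
    have hk : (k + 1 : ℂ) ≠ 0 := by exact_mod_cast Nat.succ_ne_zero k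
    refine (hsum.congr fun N => ?_).trans_eq ?_
    · rw [pow_succ, mul_inv]
      field_simp
      ring
    · congr 1
      rw [Nat.factorial_succ]
      push_cast
      have : (k.factorial : ℂ) ≠ 0 := by exact_mod_cast k.factorial_ne_zero
      field_simp
      ring

/-- Sampling `m` indices without replacement agrees asymptotically with sampling with
replacement. -/
lemma tendsto_choose_inv_mul_esymm (z : ∀ N : ℕ, Fin N → ℂ) (hz : ∀ N j, ‖z N j‖ ≤ 1) (c : ℂ)
    (h : Tendsto (fun N : ℕ => (N : ℂ)⁻¹ * ∑ j, z N j) atTop (nhds c)) (m : ℕ) :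
    Tendsto (fun N : ℕ => ((N.choose m : ℕ) : ℂ)⁻¹ *
      ∑ σ ∈ Finset.powersetCard m (Finset.univ : Finset (Fin N)), ∏ i ∈ σ, z N i)
      atTop (nhds (c ^ m)) := by
  have hone : Tendsto (fun N : ℕ => (N : ℂ)⁻¹ * ∑ _j : Fin N, (1 : ℂ)) atTop (nhds 1) := by
    refine tendsto_const_nhds.congr' ?_
    filter_upwards [eventually_gt_atTop 0] with N hN
    have : (N : ℂ) ≠ 0 := by exact_mod_cast hN.ne'
    simp [this]
  have h1 := tendsto_esymm_div_pow (fun N _ => 1) (by simp) 1 hone m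
  have h2 := tendsto_esymm_div_pow z hz c h m
  have hm : (m.factorial : ℂ) ≠ 0 := by exact_mod_cast m.factorial_ne_zero
  have h3 := h2.div h1 (by simpa using hm)
  refine (h3.congr' ?_).trans_eq ?_
  · filter_upwards [eventually_gt_atTop 0] with N hN
    have : (N : ℂ) ≠ 0 := by exact_mod_cast hN.ne'
    simp only [Pi.div_apply, Finset.prod_const_one, Finset.sum_const, Finset.card_powersetCard,
      Finset.card_univ, Fintype.card_fin, nsmul_eq_mul, mul_one]
    field_simp
  · congr 1
    field_simp
    simp

/-- The uniform distribution on the values `m^{-1/2} Σ_{j∈σ} w_j`, over `m`-subsets `σ`. -/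
noncomputable def pickLaw (N m : ℕ) (w : Fin N → ℝ) : Measure ℝ :=
  ∑ σ ∈ Finset.powersetCard m (Finset.univ : Finset (Fin N)),
    ((N.choose m : ℕ) : NNReal)⁻¹ • Measure.dirac ((Real.sqrt (m : ℝ))⁻¹ * ∑ j ∈ σ, w j)

lemma isProbabilityMeasure_pickLaw {N m : ℕ} (h : m ≤ N) (w : Fin N → ℝ) :
    IsProbabilityMeasure (pickLaw N m w) := by
  have : N.choose m ≠ 0 := (Nat.choose_pos h).ne'
  constructor
  simp only [pickLaw, Measure.finsetSum_apply, Measure.smul_apply, measure_univ, Finset.sum_const,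
    Finset.card_powersetCard, Finset.card_univ, Fintype.card_fin]
  rw [ENNReal.smul_def, nsmul_eq_mul, smul_eq_mul, mul_one, ENNReal.coe_inv (by exact_mod_cast this)]
  rw [ENNReal.coe_natCast]
  exact ENNReal.mul_inv_cancel (by exact_mod_cast this) (by simp)

lemma integral_pickLaw {E : Type*} [NormedAddCommGroup E] [NormedSpace ℝ E] [CompleteSpace E]
    (N m : ℕ) (w : Fin N → ℝ) (f : ℝ → E) :
    ∫ x, f x ∂(pickLaw N m w) = ((N.choose m : ℕ) : ℝ)⁻¹ •
      ∑ σ ∈ Finset.powersetCard m (Finset.univ : Finset (Fin N)),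
        f ((Real.sqrt (m : ℝ))⁻¹ * ∑ j ∈ σ, w j) := by
  rw [pickLaw, integral_finsetSum_measure, Finset.smul_sum]
  · refine Finset.sum_congr rfl fun σ _ => ?_
    rw [integral_smul_nnreal_measure, integral_dirac]
    simp [NNReal.smul_def]
  · intro σ _
    exact (integrable_dirac (by simp)).smul_measure_nnreal

lemma charFun_pickLaw (N m : ℕ) (w : Fin N → ℝ) (t : ℝ) :
    charFun (pickLaw N m w) t = ((N.choose m : ℕ) : ℂ)⁻¹ *
      ∑ σ ∈ Finset.powersetCard m (Finset.univ : Finset (Fin N)),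
        ∏ j ∈ σ, Complex.exp (((t * (Real.sqrt (m : ℝ))⁻¹ * w j : ℝ) : ℂ) * Complex.I) := by
  rw [charFun_apply_real, integral_pickLaw, Complex.real_smul]
  push_cast
  congr 1
  refine Finset.sum_congr rfl fun σ _ => ?_
  rw [← Complex.exp_sum]
  congr 1
  rw [← Finset.sum_mul, ← Finset.mul_sum]
  ring

lemma tendsto_pickAvg_of_tendsto_empirical (m : ℕ) (hm : 0 < m) (w : ∀ N : ℕ, Fin N → ℝ)
    (hw : ∀ t : ℝ, Tendsto (fun N : ℕ => (N : ℂ)⁻¹ *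
      ∑ j, Complex.exp (((t * w N j : ℝ) : ℂ) * Complex.I)) atTop
      (nhds (Complex.exp (-(t : ℂ) ^ 2 / 2))))
    (f : ℝ → ℝ) (hfb : ∃ B, ∀ x, |f x| ≤ B) (hf : Continuous f) :
    Tendsto (fun N => pickAvg N m (w N) f) atTop (nhds (∫ x, f x ∂(gaussianReal 0 1))) := by
  have hm' : (0 : ℝ) < m := by exact_mod_cast hm
  obtain ⟨B, hB⟩ := hfb
  let μ : ℕ → ProbabilityMeasure ℝ := fun N =>
    ⟨pickLaw (N + m) m (w (N + m)), isProbabilityMeasure_pickLaw (by omega) _⟩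
  let γ : ProbabilityMeasure ℝ := ⟨gaussianReal 0 1, inferInstance⟩
  have hμ : Tendsto μ atTop (nhds γ) := by
    refine ProbabilityMeasure.tendsto_of_tendsto_charFun fun t => ?_
    have h := tendsto_choose_inv_mul_esymm
      (fun N j => Complex.exp (((t * (Real.sqrt (m : ℝ))⁻¹ * w N j : ℝ) : ℂ) * Complex.I))
      (fun N j => (Complex.norm_exp_ofReal_mul_I _).le) _ (hw (t * (Real.sqrt (m : ℝ))⁻¹)) m
    have h' := (tendsto_add_atTop_iff_nat m).2 h
    refine (h'.congr fun N => (charFun_pickLaw _ _ _ _).symm).trans_eq ?_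
    congr 1
    change _ = charFun (gaussianReal 0 1) t
    rw [charFun_gaussianReal, ← Complex.exp_nat_mul]
    congr 1
    have hsq : ((Real.sqrt (m : ℝ) : ℝ) : ℂ) ^ 2 = m := by
      rw [← Complex.ofReal_pow, Real.sq_sqrt hm'.le, Complex.ofReal_natCast]
    have hmc : (m : ℂ) ≠ 0 := by exact_mod_cast hm.ne'
    push_cast
    rw [mul_pow, inv_pow, hsq]
    field_simp
    simp
    ring
  let F : BoundedContinuousFunction ℝ ℝ :=
    BoundedContinuousFunction.ofNormedAddCommGroup f hf B (by simpa using hB)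
  have h := (ProbabilityMeasure.tendsto_iff_forall_integral_tendsto.1 hμ) F
  refine (tendsto_add_atTop_iff_nat m).1 (h.congr fun N => ?_)
  change ∫ x, f x ∂(pickLaw (N + m) m (w (N + m))) = _
  rw [integral_pickLaw]
  rfl

lemma exists_pos_exp_mul_mgf_lt_one {Ω : Type*} [MeasurableSpace Ω] {ν : Measure Ω}
    [IsProbabilityMeasure ν]
    {h : Ω → ℝ} (h0 : 0 ∈ interior (integrableExpSet h ν)) {a : ℝ} (ha : ∫ x, h x ∂ν < a) :
    ∃ l : ℝ, 0 < l ∧ l ∈ integrableExpSet h ν ∧ Real.exp (-l * a) * mgf h ν l < 1 := by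
  have hd : HasDerivAt (fun l => Real.exp (-l * a) * mgf h ν l) (-a + ∫ x, h x ∂ν) 0 := by
    have h1 : HasDerivAt (fun l : ℝ => Real.exp (-l * a)) (Real.exp (-0 * a) * (-1 * a)) 0 :=
      ((hasDerivAt_id (0 : ℝ)).neg.mul_const a).exp
    convert! h1.mul (hasDerivAt_mgf h0) using 1
    simp
  have hneg : -a + ∫ x, h x ∂ν < 0 := by linarith
  have hs := (hasDerivAt_iff_tendsto_slope.1 hd).eventually (gt_mem_nhds hneg)
  have hs' : ∀ᶠ l in nhdsWithin (0 : ℝ) (Set.Ioi 0), slope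
      (fun l => Real.exp (-l * a) * mgf h ν l) 0 l < 0 :=
    hs.filter_mono (nhdsWithin_mono _ fun x hx => (Set.mem_Ioi.1 hx).ne')
  have hi : ∀ᶠ l in nhdsWithin (0 : ℝ) (Set.Ioi 0), l ∈ integrableExpSet h ν :=
    nhdsWithin_le_nhds (mem_interior_iff_mem_nhds.1 h0)
  obtain ⟨l, hl1, hl2, hl3⟩ := (hs'.and (hi.and self_mem_nhdsWithin)).exists
  have hl3 : 0 < l := hl3
  refine ⟨l, hl3, hl2, ?_⟩
  rw [slope_def_field] at hl1
  have := (div_neg_iff.1 hl1)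
  simp at this
  rcases this with h | h <;> [linarith; (have := h.1; simpa using this)]

/-- **Cramér's bound**: an upper deviation of a sum of i.i.d. variables is exponentially rare. -/
lemma exists_pi_real_sum_ge_le_pow {Ω : Type*} [MeasurableSpace Ω] {ν : Measure Ω}
    [IsProbabilityMeasure ν]
    {h : Ω → ℝ} (h0 : 0 ∈ interior (integrableExpSet h ν)) {a : ℝ} (ha : ∫ x, h x ∂ν < a) :
    ∃ r : ℝ, 0 ≤ r ∧ r < 1 ∧ ∀ N : ℕ,
      (Measure.pi fun _ : Fin N => ν).real {x | N * a ≤ ∑ i, h (x i)} ≤ r ^ N := by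
  obtain ⟨l, hl, hli, hlt⟩ := exists_pos_exp_mul_mgf_lt_one h0 ha
  refine ⟨_, mul_nonneg (Real.exp_pos _).le mgf_nonneg, hlt, fun N => ?_⟩
  have hint : Integrable (fun x : Fin N → Ω => Real.exp (l * ∑ i, h (x i)))
      (Measure.pi fun _ => ν) := by
    simp_rw [Finset.mul_sum, Real.exp_sum]
    exact Integrable.fintype_prod (f := fun _ y => Real.exp (l * h y)) (fun _ => hli)
  refine (measure_ge_le_exp_mul_mgf _ hl.le hint).trans_eq ?_
  have : mgf (fun x : Fin N → Ω => ∑ i, h (x i)) (Measure.pi fun _ => ν) l = mgf h ν l ^ N := by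
    simp_rw [mgf, Finset.mul_sum, Real.exp_sum]
    rw [integral_fintype_prod_eq_pow (fun y => Real.exp (l * h y)), Fintype.card_fin]
  rw [this, mul_pow, ← Real.exp_nat_mul]
  ring_nf

lemma zero_mem_interior_integrableExpSet_neg {Ω : Type*} [MeasurableSpace Ω] {ν : Measure Ω}
    {h : Ω → ℝ} (h0 : 0 ∈ interior (integrableExpSet h ν)) :
    0 ∈ interior (integrableExpSet (fun x => -h x) ν) := by
  rw [mem_interior_iff_mem_nhds] at h0 ⊢
  have : Tendsto (fun l : ℝ => -l) (nhds 0) (nhds 0) := by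
    simpa using (continuous_neg.tendsto (0 : ℝ))
  filter_upwards [this h0] with l hl
  simpa [integrableExpSet] using hl

lemma tsum_pi_abs_sum_sub_ge_ne_top {Ω : Type*} [MeasurableSpace Ω] {ν : Measure Ω}
    [IsProbabilityMeasure ν]
    {h : Ω → ℝ} (h0 : 0 ∈ interior (integrableExpSet h ν)) {ε : ℝ} (hε : 0 < ε) :
    ∑' N : ℕ, (Measure.pi fun _ : Fin N => ν)
      {x | N * ε ≤ |∑ i, h (x i) - N * ∫ y, h y ∂ν|} ≠ ⊤ := by
  obtain ⟨r, hr0, hr1, hr⟩ := exists_pi_real_sum_ge_le_pow h0 (lt_add_of_pos_right _ hε)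
  obtain ⟨s, hs0, hs1, hs⟩ := exists_pi_real_sum_ge_le_pow
    (zero_mem_interior_integrableExpSet_neg h0) (lt_add_of_pos_right _ hε)
  have hsum : Summable fun N : ℕ => r ^ N + s ^ N :=
    (summable_geometric_of_lt_one hr0 hr1).add (summable_geometric_of_lt_one hs0 hs1)
  refine ne_top_of_le_ne_top hsum.tsum_ofReal_ne_top (ENNReal.tsum_le_tsum fun N => ?_)
  rw [← ofReal_measureReal]
  refine ENNReal.ofReal_le_ofReal ((measureReal_mono ?_).trans
    ((measureReal_union_le _ _).trans (add_le_add (hr N) (hs N))))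
  intro x hx
  simp only [Set.mem_ofPred_eq, Set.mem_union, integral_neg, Finset.sum_neg_distrib] at hx ⊢
  rcases le_abs.1 hx with h | h
  · left; linarith
  · right; linarith

lemma zero_mem_interior_integrableExpSet_of_abs_le {Ω : Type*} [MeasurableSpace Ω]
    {ν : Measure Ω} [IsProbabilityMeasure ν]
    {h : Ω → ℝ} (hm : Measurable h) {C : ℝ} (hC : ∀ x, |h x| ≤ C) :
    0 ∈ interior (integrableExpSet h ν) := by
  have : integrableExpSet h ν = Set.univ := by
    refine Set.eq_univ_of_forall fun l => ?_
    refine Integrable.of_bound (C := Real.exp (|l| * C)) (by fun_prop) (ae_of_all _ fun x => ?_)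
    rw [Real.norm_eq_abs, abs_of_pos (Real.exp_pos _)]
    refine Real.exp_le_exp.2 ?_
    calc l * h x ≤ |l * h x| := le_abs_self _
      _ = |l| * |h x| := abs_mul _ _
      _ ≤ |l| * C := by gcongr; exact hC x
  simp [this]

lemma zero_mem_interior_integrableExpSet_sq_gaussianReal :
    0 ∈ interior (integrableExpSet (fun x : ℝ => x ^ 2) (gaussianReal 0 1)) := by
  obtain ⟨C, hC, hint⟩ := IsGaussian.exists_integrable_exp_sq (gaussianReal 0 1)
  rw [mem_interior_iff_mem_nhds]
  filter_upwards [gt_mem_nhds hC] with l hl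
  refine hint.mono' (by fun_prop) (ae_of_all _ fun x => ?_)
  rw [Real.norm_eq_abs, abs_of_pos (Real.exp_pos _), Real.norm_eq_abs, sq_abs]
  gcongr

lemma integral_sq_gaussianReal : ∫ x, x ^ 2 ∂(gaussianReal 0 1) = 1 := by
  have h := variance_fun_id_gaussianReal (μ := 0) (v := 1)
  rw [variance_eq_integral measurable_id'.aemeasurable] at h
  simpa using h

lemma integral_exp_mul_I_gaussianReal (t : ℝ) :
    ∫ x, Complex.exp (((t * x : ℝ) : ℂ) * Complex.I) ∂(gaussianReal 0 1) =
      Complex.exp (-(t : ℂ) ^ 2 / 2) := by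
  have h := charFun_gaussianReal (μ := 0) (v := 1) t
  rw [charFun_apply_real] at h
  push_cast
  rw [h]
  congr 1
  simp
  ring

lemma charFun_eq_of_norm_eq {E : Type*} [NormedAddCommGroup E] [InnerProductSpace ℝ E]
    [MeasurableSpace E] [BorelSpace E] {μ : Measure E}
    (hμ : ∀ U : E ≃ₗᵢ[ℝ] E, μ.map U = μ) {s t : E} (h : ‖s‖ = ‖t‖) :
    charFun μ s = charFun μ t := by
  let U := (ℝ ∙ (s - t))ᗮ.reflection
  have hU : U s = t := Submodule.reflection_sub h
  symm
  calc charFun μ t = ∫ x, Complex.exp ((inner ℝ x t : ℝ) * Complex.I) ∂(μ.map U) := by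
        rw [hμ U, charFun_apply]
    _ = ∫ x, Complex.exp ((inner ℝ (U x) t : ℝ) * Complex.I) ∂μ :=
        U.toHomeomorph.measurableEmbedding.integral_map _
    _ = charFun μ s := by
        rw [charFun_apply, ← hU]
        simp

/-- A rotation-invariant probability measure carried by a centered sphere is unique. -/
lemma eq_of_map_linearIsometryEquiv_eq {E : Type*} [NormedAddCommGroup E]
    [InnerProductSpace ℝ E] [CompleteSpace E] [SecondCountableTopology E]
    [MeasurableSpace E] [BorelSpace E] {μ ν : Measure E} [IsProbabilityMeasure μ]
    [IsProbabilityMeasure ν] (hμ : ∀ U : E ≃ₗᵢ[ℝ] E, μ.map U = μ)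
    (hν : ∀ U : E ≃ₗᵢ[ℝ] E, ν.map U = ν) {R : ℝ} (hR : 0 < R)
    (hμR : ∀ᵐ x ∂μ, ‖x‖ = R) (hνR : ∀ᵐ x ∂ν, ‖x‖ = R) : μ = ν := by
  refine Measure.ext_of_charFun (funext fun t => ?_)
  have key : ∀ {ρ κ : Measure E} [IsProbabilityMeasure ρ] [IsProbabilityMeasure κ],
      (∀ U : E ≃ₗᵢ[ℝ] E, ρ.map U = ρ) → (∀ᵐ x ∂κ, ‖x‖ = R) →
      ∫ y, charFun ρ ((‖t‖ / R) • y) ∂κ = charFun ρ t := by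
    intro ρ κ _ _ hρ hκ
    have : ∀ᵐ y ∂κ, charFun ρ ((‖t‖ / R) • y) = charFun ρ t := by
      filter_upwards [hκ] with y hy
      refine charFun_eq_of_norm_eq hρ ?_
      rw [norm_smul, hy, Real.norm_of_nonneg (by positivity)]
      field_simp
    rw [integral_congr_ae this]
    simp
  rw [← key hμ hνR, ← key hν hμR]
  simp_rw [charFun_apply]
  rw [integral_integral_swap]
  · simp_rw [inner_smul_right, real_inner_comm]
  · refine Integrable.of_bound (C := 1) ?_ (ae_of_all _ fun p => ?_)
    · refine Measurable.aestronglyMeasurable ?_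
      unfold Function.uncurry
      fun_prop
    · exact (Complex.norm_exp_ofReal_mul_I _).le

lemma map_sphereUniform {ι : Type} [Fintype ι] (r : ℝ)
    (U : EuclideanSpace ℝ ι ≃ₗᵢ[ℝ] EuclideanSpace ℝ ι) :
    (sphereUniform ι r).map U = sphereUniform ι r := by
  have hpre : U ⁻¹' Metric.sphere 0 r = Metric.sphere 0 r := by ext x; simp
  have h := U.isometry.map_hausdorffMeasure (d := ((Fintype.card ι - 1 : ℕ) : ℝ))
    (Or.inr U.surjective)
  rw [U.surjective.range_eq, Measure.restrict_univ] at h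
  unfold sphereUniform
  rw [Measure.map_smul]
  congr 1
  conv_rhs => rw [← h, Measure.restrict_map U.continuous.measurable
    Metric.isClosed_sphere.measurableSet, hpre]

lemma ae_norm_eq_sphereUniform {ι : Type} [Fintype ι] (r : ℝ) :
    ∀ᵐ x ∂(sphereUniform ι r), ‖x‖ = r := by
  refine Measure.ae_smul_measure ?_ _
  filter_upwards [ae_restrict_mem Metric.isClosed_sphere.measurableSet] with x hx
  simpa using hx

/-- The uniform measure on the sphere is the law of a normalized standard Gaussian vector. -/
lemma sphereUniform_eq_map_pi_gaussianReal {N : ℕ} (hN : 0 < N) {r : ℝ} (hr : 0 < r)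
    [IsProbabilityMeasure (sphereUniform (Fin N) r)] :
    sphereUniform (Fin N) r = (Measure.pi fun _ : Fin N => gaussianReal 0 1).map
      (fun x => (r / ‖WithLp.toLp 2 x‖) • WithLp.toLp 2 x) := by
  let T : EuclideanSpace ℝ (Fin N) → EuclideanSpace ℝ (Fin N) := fun y => (r / ‖y‖) • y
  have hT : Measurable T := by fun_prop
  have hL : Measurable (WithLp.toLp 2 : (Fin N → ℝ) → EuclideanSpace ℝ (Fin N)) := by fun_prop
  have hmap : (Measure.pi fun _ : Fin N => gaussianReal 0 1).map
      (fun x => (r / ‖WithLp.toLp 2 x‖) • WithLp.toLp 2 x) =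
      (stdGaussian (EuclideanSpace ℝ (Fin N))).map T := by
    rw [← map_pi_eq_stdGaussian, Measure.map_map hT hL]
    rfl
  rw [hmap]
  have : IsProbabilityMeasure ((stdGaussian (EuclideanSpace ℝ (Fin N))).map T) :=
    Measure.isProbabilityMeasure_map hT.aemeasurable
  refine eq_of_map_linearIsometryEquiv_eq (map_sphereUniform r) (fun U => ?_) hr
    (ae_norm_eq_sphereUniform r) ?_
  · conv_rhs => rw [← stdGaussian_map U]
    rw [Measure.map_map U.continuous.measurable hT, Measure.map_map hT U.continuous.measurable]
    congr 1
    ext1 y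
    simp [T]
  · rw [ae_map_iff hT.aemeasurable (measurableSet_eq_fun (by fun_prop) (by fun_prop)),
      ← map_pi_eq_stdGaussian, ae_map_iff hL.aemeasurable
      (measurableSet_eq_fun (by fun_prop) (by fun_prop))]
    have : NullSingletonClass (Measure.pi fun _ : Fin N => gaussianReal 0 1) :=
      have := nullSingletonClass_gaussianReal (μ := 0) (v := 1) one_ne_zero
      Measure.pi_nullSingletonClass ⟨0, hN⟩
    have h0 : ∀ᵐ x ∂(Measure.pi fun _ : Fin N => gaussianReal 0 1), x ≠ 0 := by
      simp only [ae_iff, ne_eq, not_not, Set.ofPred_eq_eq_singleton]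
      exact measure_singleton _
    filter_upwards [h0] with x hx
    have hx' : ‖(WithLp.toLp 2 x : EuclideanSpace ℝ (Fin N))‖ ≠ 0 := by simpa using hx
    rw [norm_smul, norm_div, norm_norm, Real.norm_of_nonneg hr.le, div_mul_cancel₀ _ hx']

/-- The characteristic function of the empirical measure of the coordinates of `x`. -/
noncomputable def empiricalCharFun {N : ℕ} (x : Fin N → ℝ) (t : ℝ) : ℂ :=
  (N : ℂ)⁻¹ * ∑ j, Complex.exp (((t * x j : ℝ) : ℂ) * Complex.I)

lemma norm_exp_ofReal_mul_I_sub_le (a b : ℝ) :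
    ‖Complex.exp ((a : ℂ) * Complex.I) - Complex.exp ((b : ℂ) * Complex.I)‖ ≤ |a - b| := by
  have h : Complex.exp ((a : ℂ) * Complex.I) - Complex.exp ((b : ℂ) * Complex.I) =
      Complex.exp ((b : ℂ) * Complex.I) * (Complex.exp (Complex.I * ((a - b : ℝ) : ℂ)) - 1) := by
    rw [mul_sub, ← Complex.exp_add, mul_one]
    congr 2
    push_cast
    ring
  rw [h, norm_mul, Complex.norm_exp_ofReal_mul_I, one_mul]
  exact Real.norm_exp_I_mul_ofReal_sub_one_le

lemma inv_mul_sum_abs_le_norm_div_sqrt {N : ℕ} (x : EuclideanSpace ℝ (Fin N)) :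
    (N : ℝ)⁻¹ * ∑ j, |x j| ≤ ‖x‖ / Real.sqrt N := by
  have h : ∑ j, |x j| ≤ Real.sqrt N * ‖x‖ := by
    rw [← Real.sqrt_sq (norm_nonneg x), ← Real.sqrt_mul (by positivity)]
    refine Real.le_sqrt_of_sq_le ?_
    have := sq_sum_le_card_mul_sum_sq (s := (Finset.univ : Finset (Fin N))) (f := fun j => |x j|)
    simpa [EuclideanSpace.real_norm_sq_eq] using this
  calc (N : ℝ)⁻¹ * ∑ j, |x j| ≤ (N : ℝ)⁻¹ * (Real.sqrt N * ‖x‖) := by gcongr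
    _ = ‖x‖ / Real.sqrt N := by
      rw [← mul_assoc, inv_mul_eq_div, Real.sqrt_div_self']
      ring

lemma norm_empiricalCharFun_sub_le_sum {N : ℕ} (x y : Fin N → ℝ) (s t : ℝ) :
    ‖empiricalCharFun x s - empiricalCharFun y t‖ ≤
      (N : ℝ)⁻¹ * ∑ j, |s * x j - t * y j| := by
  rw [empiricalCharFun, empiricalCharFun, ← mul_sub, ← Finset.sum_sub_distrib, norm_mul, norm_inv,
    Complex.norm_natCast]
  gcongr
  exact norm_sum_le_of_le _ fun j _ => norm_exp_ofReal_mul_I_sub_le _ _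

lemma norm_empiricalCharFun_sub_le {N : ℕ} (x y : EuclideanSpace ℝ (Fin N)) (s t : ℝ) :
    ‖empiricalCharFun x s - empiricalCharFun y t‖ ≤ ‖s • x - t • y‖ / Real.sqrt N := by
  refine (norm_empiricalCharFun_sub_le_sum _ _ _ _).trans ?_
  simpa using inv_mul_sum_abs_le_norm_div_sqrt (s • x - t • y)

lemma norm_empiricalCharFun_normalize_sub_lt {N : ℕ} (hN : 0 < N) (x : Fin N → ℝ) (t : ℝ) (c : ℂ)
    {δ : ℝ} (hδ : δ < 1) (hsq : |∑ j, x j ^ 2 - N| < N * δ)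
    (hcos : |∑ j, Real.cos (t * x j) - N * c.re| < N * δ)
    (hsin : |∑ j, Real.sin (t * x j) - N * c.im| < N * δ) :
    ‖empiricalCharFun ((Real.sqrt N / ‖WithLp.toLp 2 x‖) • WithLp.toLp 2 x :
      EuclideanSpace ℝ (Fin N)) t - c‖ < (2 + |t|) * δ := by
  have hN' : (0 : ℝ) < N := by exact_mod_cast hN
  have hs : 0 < Real.sqrt N := Real.sqrt_pos.2 hN'
  have hss : Real.sqrt N ^ 2 = N := Real.sq_sqrt hN'.le
  set y : EuclideanSpace ℝ (Fin N) := WithLp.toLp 2 x with hy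
  have hysq : ‖y‖ ^ 2 = ∑ j, x j ^ 2 := by simp [EuclideanSpace.real_norm_sq_eq, hy]
  rw [← hysq] at hsq
  have hypos : 0 < ‖y‖ := by
    refine lt_of_le_of_ne (norm_nonneg _) fun h => ?_
    rw [← h, abs_lt] at hsq
    nlinarith [hsq.1]
  have h1 : ‖empiricalCharFun ((Real.sqrt N / ‖y‖) • y : EuclideanSpace ℝ (Fin N)) t -
      empiricalCharFun y t‖ ≤ |t| * δ := by
    refine (norm_empiricalCharFun_sub_le _ _ _ _).trans ?_
    rw [← smul_sub, norm_smul, Real.norm_eq_abs, mul_div_assoc]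
    gcongr
    have h2 : (Real.sqrt N / ‖y‖) • y - y = ((Real.sqrt N - ‖y‖) / ‖y‖) • y := by
      rw [sub_div, div_self hypos.ne', sub_smul, one_smul]
    rw [h2, norm_smul, norm_div, norm_norm, div_mul_cancel₀ _ hypos.ne', Real.norm_eq_abs,
      div_le_iff₀ hs]
    have h3 : |Real.sqrt N - ‖y‖| * (Real.sqrt N + ‖y‖) = |‖y‖ ^ 2 - N| := by
      have hfac : (N : ℝ) - ‖y‖ ^ 2 = (Real.sqrt N + ‖y‖) * (Real.sqrt N - ‖y‖) := by
        rw [← sq_sub_sq, hss]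
      rw [abs_sub_comm (‖y‖ ^ 2), hfac, abs_mul, abs_of_pos (add_pos hs hypos), mul_comm]
    have h4 : |Real.sqrt N - ‖y‖| * Real.sqrt N ≤ δ * Real.sqrt N * Real.sqrt N := by
      nlinarith [abs_nonneg (Real.sqrt N - ‖y‖)]
    exact le_of_mul_le_mul_right h4 hs
  have h2 : ‖empiricalCharFun y t - c‖ < 2 * δ := by
    have hre : (empiricalCharFun y t - c).re =
        (N : ℝ)⁻¹ * (∑ j, Real.cos (t * x j) - N * c.re) := by
      have : (empiricalCharFun y t).re = (N : ℝ)⁻¹ * ∑ j, Real.cos (t * x j) := by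
        rw [empiricalCharFun, ← Complex.ofReal_natCast, ← Complex.ofReal_inv, Complex.re_ofReal_mul,
          Complex.re_sum]
        simp only [Complex.exp_ofReal_mul_I_re]
        rfl
      rw [Complex.sub_re, this]
      field_simp
    have him : (empiricalCharFun y t - c).im =
        (N : ℝ)⁻¹ * (∑ j, Real.sin (t * x j) - N * c.im) := by
      have : (empiricalCharFun y t).im = (N : ℝ)⁻¹ * ∑ j, Real.sin (t * x j) := by
        rw [empiricalCharFun, ← Complex.ofReal_natCast, ← Complex.ofReal_inv, Complex.im_ofReal_mul,
          Complex.im_sum]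
        simp only [Complex.exp_ofReal_mul_I_im]
        rfl
      rw [Complex.sub_im, this]
      field_simp
    refine (Complex.norm_le_abs_re_add_abs_im _).trans_lt ?_
    rw [hre, him, abs_mul, abs_mul, abs_of_pos (inv_pos.2 hN'), two_mul]
    gcongr <;> rwa [inv_mul_lt_iff₀ hN']
  calc _ ≤ _ := norm_sub_le_norm_sub_add_norm_sub _ (empiricalCharFun y t) _
    _ < (2 + |t|) * δ := by linarith

lemma measurable_empiricalCharFun {N : ℕ} (t : ℝ) :
    Measurable fun x : EuclideanSpace ℝ (Fin N) => empiricalCharFun x t := by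
  unfold empiricalCharFun
  fun_prop

/-- The empirical characteristic function on the sphere converges completely to the Gaussian
one. -/
lemma tsum_sphereUniform_empiricalCharFun_ne_top
    (hprob : ∀ N : ℕ, IsProbabilityMeasure (sphereUniform (Fin N) (Real.sqrt (N : ℝ))))
    (t : ℝ) {ε : ℝ} (hε : 0 < ε) :
    ∑' N : ℕ, sphereUniform (Fin N) (Real.sqrt (N : ℝ))
      {w | ε ≤ ‖empiricalCharFun w t - Complex.exp (-(t : ℂ) ^ 2 / 2)‖} ≠ ⊤ := by
  set c : ℂ := Complex.exp (-(t : ℂ) ^ 2 / 2) with hc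
  have hInt : Integrable (fun x : ℝ => Complex.exp (((t * x : ℝ) : ℂ) * Complex.I))
      (gaussianReal 0 1) :=
    Integrable.of_bound (C := 1) (by fun_prop)
      (ae_of_all _ fun x => (Complex.norm_exp_ofReal_mul_I _).le)
  have hcos : ∫ x, Real.cos (t * x) ∂(gaussianReal 0 1) = c.re := by
    rw [hc, ← integral_exp_mul_I_gaussianReal, ← RCLike.re_eq_complex_re, ← integral_re hInt]
    simp only [RCLike.re_eq_complex_re, Complex.exp_ofReal_mul_I_re]
  have hsin : ∫ x, Real.sin (t * x) ∂(gaussianReal 0 1) = c.im := by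
    rw [hc, ← integral_exp_mul_I_gaussianReal, ← RCLike.im_eq_complex_im, ← integral_im hInt]
    simp only [RCLike.im_eq_complex_im, Complex.exp_ofReal_mul_I_im]
  obtain ⟨δ, hδ0, hδ1, hδε⟩ : ∃ δ : ℝ, 0 < δ ∧ δ < 1 ∧ (2 + |t|) * δ ≤ ε := by
    have ht : 0 < 2 + |t| := by positivity
    refine ⟨min (1 / 2) (ε / (2 + |t|)), by positivity,
      (min_le_left _ _).trans_lt (by norm_num), ?_⟩
    calc (2 + |t|) * min (1 / 2) (ε / (2 + |t|)) ≤ (2 + |t|) * (ε / (2 + |t|)) := by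
          gcongr
          exact min_le_right _ _
      _ = ε := by field_simp
  have s1 := tsum_pi_abs_sum_sub_ge_ne_top
    zero_mem_interior_integrableExpSet_sq_gaussianReal hδ0
  have s2 := tsum_pi_abs_sum_sub_ge_ne_top (ν := gaussianReal 0 1)
    (zero_mem_interior_integrableExpSet_of_abs_le (h := fun x => Real.cos (t * x)) (by fun_prop)
      (fun x => Real.abs_cos_le_one _)) hδ0
  have s3 := tsum_pi_abs_sum_sub_ge_ne_top (ν := gaussianReal 0 1)
    (zero_mem_interior_integrableExpSet_of_abs_le (h := fun x => Real.sin (t * x)) (by fun_prop)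
      (fun x => Real.abs_sin_le_one _)) hδ0
  rw [integral_sq_gaussianReal] at s1
  rw [hcos] at s2
  rw [hsin] at s3
  refine ne_top_of_le_ne_top (ENNReal.add_ne_top.2 ⟨ENNReal.add_ne_top.2 ⟨s1, s2⟩, s3⟩) ?_
  rw [← ENNReal.tsum_add, ← ENNReal.tsum_add]
  refine ENNReal.tsum_le_tsum fun N => ?_
  rcases Nat.eq_zero_or_pos N with rfl | hN
  · refine prob_le_one.trans ?_
    simp
  have hr : 0 < Real.sqrt N := Real.sqrt_pos.2 (by exact_mod_cast hN)
  have hB : MeasurableSet {w : EuclideanSpace ℝ (Fin N) | ε ≤ ‖empiricalCharFun w t - c‖} :=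
    measurableSet_le measurable_const ((measurable_empiricalCharFun t).sub_const c).norm
  rw [sphereUniform_eq_map_pi_gaussianReal hN hr, Measure.map_apply (by fun_prop) hB]
  refine (measure_mono ?_).trans ((measure_union_le _ _).trans
    (add_le_add_left (measure_union_le _ _) _))
  intro x hx
  by_contra hcon
  simp only [Set.mem_union, Set.mem_ofPred_eq, not_or, not_le, mul_one] at hcon
  exact absurd hx (not_le.2 ((norm_empiricalCharFun_normalize_sub_lt hN x t c hδ1 hcon.1.1
    hcon.1.2 hcon.2).trans_le hδε))

lemma tendsto_empiricalCharFun_of_rat (x : ∀ N : ℕ, EuclideanSpace ℝ (Fin N))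
    (hx : ∀ N, ‖x N‖ = Real.sqrt N)
    (h : ∀ q : ℚ, Tendsto (fun N => empiricalCharFun (x N) (q : ℝ)) atTop
      (nhds (Complex.exp (-((q : ℝ) : ℂ) ^ 2 / 2)))) (t : ℝ) :
    Tendsto (fun N => empiricalCharFun (x N) t) atTop
      (nhds (Complex.exp (-(t : ℂ) ^ 2 / 2))) := by
  rw [Metric.tendsto_atTop']
  intro ε hε
  have hcont : Continuous fun s : ℝ => Complex.exp (-(s : ℂ) ^ 2 / 2) := by fun_prop
  obtain ⟨η, hη, hηc⟩ := Metric.continuous_iff.1 hcont t (ε / 3) (by positivity)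
  obtain ⟨q, hq1, hq2⟩ := exists_rat_btwn (lt_add_of_pos_right t (lt_min hη (div_pos hε three_pos)))
  have hqt : |(q : ℝ) - t| < min η (ε / 3) := by
    rw [abs_of_pos (by linarith)]; linarith
  obtain ⟨N₀, hN₀⟩ := Metric.tendsto_atTop'.1 (h q) (ε / 3) (by positivity)
  refine ⟨N₀, fun N hN => ?_⟩
  have h1 : dist (empiricalCharFun (x N) t) (empiricalCharFun (x N) (q : ℝ)) < ε / 3 := by
    rw [dist_eq_norm]
    refine (norm_empiricalCharFun_sub_le _ _ _ _).trans_lt ?_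
    rw [← sub_smul, norm_smul, hx, Real.norm_eq_abs, abs_sub_comm, mul_div_assoc,
      div_self (Real.sqrt_pos.2 (by exact_mod_cast (Nat.zero_le _).trans_lt hN)).ne', mul_one]
    exact hqt.trans_le (min_le_right _ _)
  have h3 := hηc (q : ℝ) (by rw [Real.dist_eq]; exact hqt.trans_le (min_le_left _ _))
  calc _ ≤ _ := dist_triangle4 _ (empiricalCharFun (x N) (q : ℝ))
        (Complex.exp (-((q : ℝ) : ℂ) ^ 2 / 2)) _
    _ < ε := by linarith [hN₀ N hN]

/-- Finitely many uniform picks from the sphere `√N·S^{N-1}`: almost surely, the quenched law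
converges weakly to the standard Gaussian. -/
theorem stmt17
    (Ω : Type) [MeasurableSpace Ω] (P : Measure Ω) [IsProbabilityMeasure P]
    (W : ∀ N : ℕ, Ω → EuclideanSpace ℝ (Fin N))
    (hmeas : ∀ N, Measurable (W N))
    (hlaw : ∀ N, Measure.map (W N) P = sphereUniform (Fin N) (Real.sqrt (N : ℝ)))
    (m : ℕ) (hm : 0 < m) :
    ∀ᵐ ω ∂P, ∀ f : ℝ → ℝ, (∃ B, ∀ x, |f x| ≤ B) → LipschitzWith 1 f →
      Tendsto (fun N => pickAvg N m (W N ω) f) atTop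
        (nhds (∫ x, f x ∂(gaussianReal 0 1))) := by
  have hprob : ∀ N : ℕ, IsProbabilityMeasure (sphereUniform (Fin N) (Real.sqrt (N : ℝ))) :=
    fun N => hlaw N ▸ Measure.isProbabilityMeasure_map (hmeas N).aemeasurable
  have hnorm : ∀ᵐ ω ∂P, ∀ N, ‖W N ω‖ = Real.sqrt N := by
    rw [ae_all_iff]
    intro N
    have h := ae_norm_eq_sphereUniform (ι := Fin N) (Real.sqrt N)
    rw [← hlaw N] at h
    exact ae_of_ae_map (hmeas N).aemeasurable h
  have hrat : ∀ᵐ ω ∂P, ∀ (q : ℚ) (k : ℕ), ∀ᶠ N in atTop,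
      ‖empiricalCharFun (W N ω) (q : ℝ) - Complex.exp (-((q : ℝ) : ℂ) ^ 2 / 2)‖ <
        1 / ((k : ℝ) + 1) := by
    rw [ae_all_iff]
    intro q
    rw [ae_all_iff]
    intro k
    have h := tsum_sphereUniform_empiricalCharFun_ne_top hprob (q : ℝ)
      (Nat.one_div_pos_of_nat (α := ℝ) (n := k))
    have hB : ∀ N : ℕ, MeasurableSet {w : EuclideanSpace ℝ (Fin N) |
        1 / ((k : ℝ) + 1) ≤
          ‖empiricalCharFun w (q : ℝ) - Complex.exp (-((q : ℝ) : ℂ) ^ 2 / 2)‖} := fun N =>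
      measurableSet_le measurable_const ((measurable_empiricalCharFun _).sub_const _).norm
    simp_rw [← hlaw, Measure.map_apply (hmeas _) (hB _)] at h
    filter_upwards [ae_eventually_notMem h] with ω hω
    filter_upwards [hω] with N hN
    exact not_le.1 hN
  filter_upwards [hnorm, hrat] with ω hω hωq f hfb hf
  refine tendsto_pickAvg_of_tendsto_empirical m hm (fun N => W N ω) ?_ f hfb hf.continuous
  refine tendsto_empiricalCharFun_of_rat (fun N => W N ω) hω fun q => ?_
  rw [Metric.tendsto_nhds]
  intro ε hε
  obtain ⟨k, hk⟩ := exists_nat_one_div_lt hε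
  filter_upwards [hωq q k] with N hN
  rw [dist_eq_norm]
  exact hN.trans hk
end
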